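/- arXiv:2301.07935 — 2 statements merged into one kernel-verified Lean document; each statement's English description precedes it below -/
import Mathlib

section
/- Define the nonnegative density J^M(t,x) := ½ (t−x₁+1)^{(p−5)/2} [ |x₂(∂_tφ + ∂₁φ) + (t−x₁+1)∂₂φ|² + |(t−x₁+1)(∂_tφ − ∂₁φ) + x₂∂₂φ + φ|² + (2/(p+1))((t−x₁+1)² + x₂²)|φ|^{p+1} ](t,x). Then for every T ≥ 0 one has the energy estimate ∫_{{x₁ ≤ T}} J^M(T,x) dx ≤ ∫_{{x₁ ≤ 0}} J^M(0,x) dx + ∫₀^T ∫_ℝ [ |x₂(∂_tφ + ∂₁φ)(t, t, x₂) + ∂₂φ(t, t, x₂)|² + (2/(p+1)) |φ(t, t, x₂)|^{p+1} ] dx₂ dt. -/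
noncomputable section

open MeasureTheory Real Set Filter Pointwise

/-- The Euclidean plane. -/
abbrev E2 : Type := EuclideanSpace ℝ (Fin 2)

/-- Time derivative `∂ₜφ`. -/
def pt (φ : ℝ → E2 → ℝ) (t : ℝ) (x : E2) : ℝ := deriv (fun s => φ s x) t

/-- Second time derivative `∂ₜ²φ`. -/
def ptt (φ : ℝ → E2 → ℝ) (t : ℝ) (x : E2) : ℝ := deriv (fun s => pt φ s x) t

/-- Spatial partial derivative `∂ᵢ f` in the `i`-th coordinate direction. -/
def pdx (i : Fin 2) (f : E2 → ℝ) (x : E2) : ℝ := fderiv ℝ f x (EuclideanSpace.single i 1)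

/-- Spatial Laplacian `Δf`. -/
def lap (f : E2 → ℝ) (x : E2) : ℝ := ∑ i : Fin 2, pdx i (pdx i f) x

/-- Squared norm of the spatial gradient `|∇f|²`. -/
def gradSq (f : E2 → ℝ) (x : E2) : ℝ := ∑ i : Fin 2, (pdx i f x) ^ 2

/-- Squared norm of the spatial Hessian `|∇²f|²`. -/
def hessSq (f : E2 → ℝ) (x : E2) : ℝ := ∑ i : Fin 2, ∑ j : Fin 2, (pdx i (pdx j f) x) ^ 2

/-- `φ` solves the defocusing wave equation `∂ₜ²φ - Δφ = -|φ|^{p-1}φ` on all of `ℝ × ℝ²`. -/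
def IsWaveSolR2 (p : ℝ) (φ : ℝ → E2 → ℝ) : Prop :=
  ∀ t : ℝ, ∀ x : E2, ptt φ t x - lap (φ t) x = -(|φ t x| ^ (p-1) * φ t x)

/-- Integrand of the weighted (conformal) energy `E_{0,2}` of the data `(φ₀, φ₁)`. -/
def e02Integrand (p : ℝ) (φ₀ φ₁ : E2 → ℝ) (x : E2) : ℝ :=
  (1+‖x‖)^2 * (gradSq φ₀ x + (φ₁ x)^2) + (1+‖x‖)^2 * |φ₀ x| ^ (p+1)

/-- The weighted energy `E_{0,2}` on the whole plane. -/
def E02R (p : ℝ) (φ₀ φ₁ : E2 → ℝ) : ℝ := ∫ x : E2, e02Integrand p φ₀ φ₁ x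

/-- The point `(a, b)` of the Euclidean plane. -/
def mkE (a b : ℝ) : E2 := EuclideanSpace.single 0 a + EuclideanSpace.single 1 b

/-- The nonnegative energy density `J^M`. -/
def JM (p : ℝ) (φ : ℝ → E2 → ℝ) (t : ℝ) (x : E2) : ℝ :=
  (1/2) * (t - x 0 + 1) ^ ((p-5)/2) *
    ((x 1 * (pt φ t x + pdx 0 (φ t) x) + (t - x 0 + 1) * pdx 1 (φ t) x)^2
      + ((t - x 0 + 1) * (pt φ t x - pdx 0 (φ t) x) + x 1 * pdx 1 (φ t) x + φ t x)^2
      + (2/(p+1)) * ((t - x 0 + 1)^2 + (x 1)^2) * |φ t x| ^ (p+1))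

lemma intervalIntegral_swap_of_continuous {F : ℝ → ℝ → ℝ}
    (hF : Continuous (Function.uncurry F)) (a b c d : ℝ) :
    ∫ s in a..b, ∫ y in c..d, F s y = ∫ y in c..d, ∫ s in a..b, F s y := by
  apply intervalIntegral_intervalIntegral_swap
  exact (hF.integrableOn_Icc (a := (min a b, min c d)) (b := (max a b, max c d))).mono_set
    (by rw [← Icc_prod_Icc]; exact prod_mono Ioc_subset_Icc_self Ioc_subset_Icc_self)

/-- The divergence inequality `∂ₜP ≤ ∂ₛA - ∂ᵧC` on a space-time box, integrated. -/
lemma box_energy_le {P A C Pt As Cy : ℝ → ℝ → ℝ → ℝ} {T a b M : ℝ}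
    (hT : 0 ≤ T) (hab : a ≤ b) (hM : 0 ≤ M)
    (cP : Continuous fun q : ℝ × ℝ × ℝ => P q.1 q.2.1 q.2.2)
    (cPt : Continuous fun q : ℝ × ℝ × ℝ => Pt q.1 q.2.1 q.2.2)
    (cAs : Continuous fun q : ℝ × ℝ × ℝ => As q.1 q.2.1 q.2.2)
    (cCy : Continuous fun q : ℝ × ℝ × ℝ => Cy q.1 q.2.1 q.2.2)
    (dP : ∀ t, ∀ s ∈ Icc a b, ∀ y, HasDerivAt (fun r => P r s y) (Pt t s y) t)
    (dA : ∀ t, ∀ s ∈ Icc a b, ∀ y, HasDerivAt (fun r => A t r y) (As t s y) s)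
    (dC : ∀ t, ∀ s ∈ Icc a b, ∀ y, HasDerivAt (fun r => C t s r) (Cy t s y) y)
    (hC : ∀ t ∈ Icc 0 T, ∀ s ∈ Icc a b, C t s M = 0 ∧ C t s (-M) = 0)
    (hle : ∀ t ∈ Icc 0 T, ∀ s ∈ Icc a b, ∀ y, Pt t s y ≤ As t s y - Cy t s y) :
    ∫ s in a..b, ∫ y in -M..M, P T s y ≤
      (∫ s in a..b, ∫ y in -M..M, P 0 s y) +
        ∫ t in 0..T, ∫ y in -M..M, (A t b y - A t a y) := by
  have hM' : -M ≤ M := by linarith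
  have slice2 : ∀ {G : ℝ → ℝ → ℝ → ℝ} (_ : Continuous fun q : ℝ × ℝ × ℝ => G q.1 q.2.1 q.2.2)
      (t : ℝ), Continuous (Function.uncurry (G t)) := fun hG t =>
    hG.comp (f := fun z : ℝ × ℝ => (t, z.1, z.2)) (by fun_prop)
  have slice1 : ∀ {G : ℝ → ℝ → ℝ → ℝ} (_ : Continuous fun q : ℝ × ℝ × ℝ => G q.1 q.2.1 q.2.2)
      (t s : ℝ), Continuous (G t s) := fun hG t s =>
    hG.comp (f := fun z : ℝ => (t, s, z)) (by fun_prop)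
  have inner : ∀ {G : ℝ → ℝ → ℝ → ℝ} (_ : Continuous fun q : ℝ × ℝ × ℝ => G q.1 q.2.1 q.2.2),
      Continuous (Function.uncurry fun t s => ∫ y in -M..M, G t s y) := fun {G} hG => by
    have := intervalIntegral.continuous_parametric_intervalIntegral_of_continuous' (μ := volume)
      (f := fun (z : ℝ × ℝ) y => G z.1 z.2 y)
      (hG.comp (f := fun z : (ℝ × ℝ) × ℝ => (z.1.1, z.1.2, z.2)) (by fun_prop)) (-M) M
    exact this
  have mid : ∀ {G : ℝ → ℝ → ℝ → ℝ} (_ : Continuous fun q : ℝ × ℝ × ℝ => G q.1 q.2.1 q.2.2),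
      Continuous (fun t => ∫ s in a..b, ∫ y in -M..M, G t s y) := fun {G} hG =>
    intervalIntegral.continuous_parametric_intervalIntegral_of_continuous' (inner hG) a b
  have eP : ∫ t in 0..T, ∫ s in a..b, ∫ y in -M..M, Pt t s y =
      (∫ s in a..b, ∫ y in -M..M, P T s y) - ∫ s in a..b, ∫ y in -M..M, P 0 s y := by
    rw [intervalIntegral_swap_of_continuous (inner cPt),
      ← intervalIntegral.integral_sub]
    · refine intervalIntegral.integral_congr fun s hs => ?_
      rw [uIcc_of_le hab] at hs
      have h1 : ∫ t in 0..T, ∫ y in -M..M, Pt t s y = ∫ y in -M..M, ∫ t in 0..T, Pt t s y :=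
        intervalIntegral_swap_of_continuous (F := fun t y => Pt t s y)
          (cPt.comp (f := fun z : ℝ × ℝ => (z.1, s, z.2)) (by fun_prop)) _ _ _ _
      simp only [h1]
      rw [← intervalIntegral.integral_sub ((slice1 cP _ _).intervalIntegrable _ _)
        ((slice1 cP _ _).intervalIntegrable _ _)]
      refine intervalIntegral.integral_congr fun y _ => ?_
      exact intervalIntegral.integral_eq_sub_of_hasDerivAt (fun t _ => dP t s hs y)
        ((cPt.comp (f := fun z : ℝ => (z, s, y)) (by fun_prop)).intervalIntegrable _ _)
    · exact ((inner cP).comp (f := fun s : ℝ => (T, s)) (by fun_prop)).intervalIntegrable _ _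
    · exact ((inner cP).comp (f := fun s : ℝ => ((0 : ℝ), s)) (by fun_prop)).intervalIntegrable _ _
  have eA : ∫ t in 0..T, ∫ s in a..b, ∫ y in -M..M, As t s y =
      ∫ t in 0..T, ∫ y in -M..M, (A t b y - A t a y) := by
    refine intervalIntegral.integral_congr fun t _ => ?_
    have h1 := intervalIntegral_swap_of_continuous (slice2 cAs t) a b (-M) M
    simp only [h1]
    refine intervalIntegral.integral_congr fun y _ => ?_
    exact intervalIntegral.integral_eq_sub_of_hasDerivAt
      (fun s hs => dA t s (by rwa [uIcc_of_le hab] at hs) y)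
      ((cAs.comp (f := fun z : ℝ => (t, z, y)) (by fun_prop)).intervalIntegrable _ _)
  have eC : ∫ t in 0..T, ∫ s in a..b, ∫ y in -M..M, Cy t s y = 0 := by
    refine (intervalIntegral.integral_congr (g := fun _ => 0) fun t ht => ?_).trans (by simp)
    rw [uIcc_of_le hT] at ht
    refine (intervalIntegral.integral_congr (g := fun _ => 0) fun s hs => ?_).trans (by simp)
    rw [uIcc_of_le hab] at hs
    dsimp only
    rw [intervalIntegral.integral_eq_sub_of_hasDerivAt (fun y _ => dC t s hs y)
      ((slice1 cCy _ _).intervalIntegrable _ _), (hC t ht s hs).1, (hC t ht s hs).2, sub_zero]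
  have key : ∫ t in 0..T, ∫ s in a..b, ∫ y in -M..M, Pt t s y ≤
      (∫ t in 0..T, ∫ s in a..b, ∫ y in -M..M, As t s y) -
        ∫ t in 0..T, ∫ s in a..b, ∫ y in -M..M, Cy t s y := by
    rw [← intervalIntegral.integral_sub ((mid cAs).intervalIntegrable _ _)
      ((mid cCy).intervalIntegrable _ _)]
    refine intervalIntegral.integral_mono_on hT ((mid cPt).intervalIntegrable _ _)
      (((mid cAs).sub (mid cCy)).intervalIntegrable _ _) fun t ht => ?_
    have c1 := fun {G : ℝ → ℝ → ℝ → ℝ}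
      (hG : Continuous fun q : ℝ × ℝ × ℝ => G q.1 q.2.1 q.2.2) =>
      (inner hG).comp (f := fun s : ℝ => (t, s)) (by fun_prop)
    have e1 : (∫ s in a..b, ∫ y in -M..M, As t s y) - (∫ s in a..b, ∫ y in -M..M, Cy t s y)
        = ∫ s in a..b, ((∫ y in -M..M, As t s y) - ∫ y in -M..M, Cy t s y) :=
      (intervalIntegral.integral_sub ((c1 cAs).intervalIntegrable _ _)
        ((c1 cCy).intervalIntegrable _ _)).symm
    rw [e1]
    refine intervalIntegral.integral_mono_on hab ((c1 cPt).intervalIntegrable _ _)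
      (((c1 cAs).sub (c1 cCy)).intervalIntegrable _ _) fun s hs => ?_
    rw [← intervalIntegral.integral_sub ((slice1 cAs _ _).intervalIntegrable _ _)
      ((slice1 cCy _ _).intervalIntegrable _ _)]
    exact intervalIntegral.integral_mono_on hM' ((slice1 cPt _ _).intervalIntegrable _ _)
      (((slice1 cAs _ _).sub (slice1 cCy _ _)).intervalIntegrable _ _)
      fun y _ => hle t ht s hs y
  linarith [eP, eA, eC, key]

/-- A causal cutoff in the coordinates `(t, x₁ - t, x₂)`. -/
def causalCutoff (N t s y : ℝ) : ℝ :=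
  smoothTransition (N - exp t * (1 + (t + s) ^ 2 + y ^ 2))

lemma causalCutoff_nonneg (N t s y : ℝ) : 0 ≤ causalCutoff N t s y := smoothTransition.nonneg _

lemma causalCutoff_le_one (N t s y : ℝ) : causalCutoff N t s y ≤ 1 := smoothTransition.le_one _

lemma continuous_causalCutoff (N : ℝ) :
    Continuous fun q : ℝ × ℝ × ℝ => causalCutoff N q.1 q.2.1 q.2.2 :=
  smoothTransition.continuous.comp (by fun_prop)

lemma causalCutoff_eq_zero {N t s y : ℝ} (ht : 0 ≤ t) (h : N ≤ (t + s) ^ 2 + y ^ 2) :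
    causalCutoff N t s y = 0 := by
  apply smoothTransition.zero_of_nonpos
  nlinarith [one_le_exp ht, sq_nonneg (t + s), sq_nonneg y]

lemma tendsto_causalCutoff (t s y : ℝ) :
    Tendsto (fun n : ℕ => causalCutoff n t s y) atTop (nhds 1) := by
  apply tendsto_const_nhds.congr'
  filter_upwards [eventually_ge_atTop ⌈exp t * (1 + (t + s) ^ 2 + y ^ 2) + 1⌉₊] with n hn
  have := Nat.ceil_le.mp hn
  exact (smoothTransition.one_of_one_le (by linarith)).symm

lemma hasDerivAt_smoothTransition (x : ℝ) :
    HasDerivAt smoothTransition (deriv smoothTransition x) x :=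
  ((smoothTransition.contDiff (n := 1)).differentiable (by simp) x).hasDerivAt

lemma continuous_deriv_smoothTransition : Continuous (deriv smoothTransition) :=
  (smoothTransition.contDiff (n := 1)).continuous_deriv (by simp)

/-- Localised energy inequality for a current `(P, A, C)` that satisfies the dominant energy
condition `hdec`. -/
lemma cutoff_energy_le {P A C Pt As Cy : ℝ → ℝ → ℝ → ℝ} {T a b M N : ℝ}
    (hT : 0 ≤ T) (hab : a ≤ b) (hM : 0 ≤ M) (hMN : N ≤ M ^ 2)
    (cP : Continuous fun q : ℝ × ℝ × ℝ => P q.1 q.2.1 q.2.2)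
    (cA : Continuous fun q : ℝ × ℝ × ℝ => A q.1 q.2.1 q.2.2)
    (cC : Continuous fun q : ℝ × ℝ × ℝ => C q.1 q.2.1 q.2.2)
    (cPt : Continuous fun q : ℝ × ℝ × ℝ => Pt q.1 q.2.1 q.2.2)
    (cAs : Continuous fun q : ℝ × ℝ × ℝ => As q.1 q.2.1 q.2.2)
    (cCy : Continuous fun q : ℝ × ℝ × ℝ => Cy q.1 q.2.1 q.2.2)
    (dP : ∀ t, ∀ s ∈ Icc a b, ∀ y, HasDerivAt (fun r => P r s y) (Pt t s y) t)
    (dA : ∀ t, ∀ s ∈ Icc a b, ∀ y, HasDerivAt (fun r => A t r y) (As t s y) s)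
    (dC : ∀ t, ∀ s ∈ Icc a b, ∀ y, HasDerivAt (fun r => C t s r) (Cy t s y) y)
    (hle : ∀ t ∈ Icc 0 T, ∀ s ∈ Icc a b, ∀ y, Pt t s y ≤ As t s y - Cy t s y)
    (hdec : ∀ t ∈ Icc 0 T, ∀ s ∈ Icc a b, ∀ y,
      0 ≤ (1 + (t + s) ^ 2 + y ^ 2) * P t s y + 2 * (t + s) * (P t s y - A t s y)
        + 2 * y * C t s y) :
    ∫ s in a..b, ∫ y in -M..M, causalCutoff N T s y * P T s y ≤
      (∫ s in a..b, ∫ y in -M..M, causalCutoff N 0 s y * P 0 s y) +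
        ∫ t in 0..T, ∫ y in -M..M,
          (causalCutoff N t b y * A t b y - causalCutoff N t a y * A t a y) := by
  set h' : ℝ → ℝ → ℝ → ℝ := fun t s y =>
    deriv smoothTransition (N - exp t * (1 + (t + s) ^ 2 + y ^ 2)) with hh'
  have ch' : Continuous fun q : ℝ × ℝ × ℝ => h' q.1 q.2.1 q.2.2 :=
    continuous_deriv_smoothTransition.comp (by fun_prop)
  have hanti : ∀ t s y, 0 ≤ h' t s y := fun _ _ _ => smoothTransition.monotone.deriv_nonneg
  have cχ := continuous_causalCutoff N
  have dt : ∀ t s y, HasDerivAt (fun r => causalCutoff N r s y)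
      (h' t s y * (-(exp t * (1 + (t + s) ^ 2 + y ^ 2) + exp t * (2 * (t + s))))) t := by
    intro t s y
    refine (hasDerivAt_smoothTransition _).comp t ?_
    exact (((hasDerivAt_exp t).fun_mul (((((hasDerivAt_id' t).add_const s).fun_pow 2).const_add
      1).add_const (y ^ 2))).const_sub N).congr_deriv (by simp)
  have ds : ∀ t s y, HasDerivAt (fun r => causalCutoff N t r y)
      (h' t s y * (-(exp t * (2 * (t + s))))) s := by
    intro t s y
    refine (hasDerivAt_smoothTransition _).comp s ?_
    exact (((((((hasDerivAt_id' s).const_add t).fun_pow 2).const_add 1).add_const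
      (y ^ 2)).const_mul (exp t)).const_sub N).congr_deriv (by simp)
  have dy : ∀ t s y, HasDerivAt (fun r => causalCutoff N t s r)
      (h' t s y * (-(exp t * (2 * y)))) y := by
    intro t s y
    refine (hasDerivAt_smoothTransition _).comp y ?_
    exact (((((hasDerivAt_id' y).fun_pow 2).const_add (1 + (t + s) ^ 2)).const_mul
      (exp t)).const_sub N).congr_deriv (by simp)
  refine box_energy_le (P := fun t s y => causalCutoff N t s y * P t s y)
    (A := fun t s y => causalCutoff N t s y * A t s y)
    (C := fun t s y => causalCutoff N t s y * C t s y) hT hab hM (by fun_prop)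
    (by fun_prop) (by fun_prop) (by fun_prop)
    (fun t s hs y => (dt t s y).mul (dP t s hs y))
    (fun t s hs y => (ds t s y).mul (dA t s hs y))
    (fun t s hs y => (dy t s y).mul (dC t s hs y)) ?_ ?_
  · intro t ht s _
    constructor <;>
    · rw [causalCutoff_eq_zero ht.1 (by nlinarith [sq_nonneg (t + s)]), zero_mul]
  · intro t ht s hs y
    have h1 := mul_nonneg (mul_nonneg (hanti t s y) (exp_pos t).le) (hdec t ht s hs y)
    have h2 := mul_le_mul_of_nonneg_left (hle t ht s hs y) (causalCutoff_nonneg N t s y)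
    nlinarith [h1, h2]

section

/-- The first and second order derivatives of a solution `ψ` of the defocusing wave equation in
the coordinates `(t, x₁ - t, x₂)`: `L = ∂ₜ + ∂₁`, `X = ∂₁`, `Y = ∂₂`. -/
structure NullFrame (p : ℝ) (ψ L X Y LL LX LY XY YY : ℝ → ℝ → ℝ → ℝ) : Prop where
  cψ : Continuous fun q : ℝ × ℝ × ℝ => ψ q.1 q.2.1 q.2.2
  cL : Continuous fun q : ℝ × ℝ × ℝ => L q.1 q.2.1 q.2.2
  cX : Continuous fun q : ℝ × ℝ × ℝ => X q.1 q.2.1 q.2.2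
  cY : Continuous fun q : ℝ × ℝ × ℝ => Y q.1 q.2.1 q.2.2
  cLL : Continuous fun q : ℝ × ℝ × ℝ => LL q.1 q.2.1 q.2.2
  cLX : Continuous fun q : ℝ × ℝ × ℝ => LX q.1 q.2.1 q.2.2
  cLY : Continuous fun q : ℝ × ℝ × ℝ => LY q.1 q.2.1 q.2.2
  cXY : Continuous fun q : ℝ × ℝ × ℝ => XY q.1 q.2.1 q.2.2
  cYY : Continuous fun q : ℝ × ℝ × ℝ => YY q.1 q.2.1 q.2.2
  ψt : ∀ t s y, HasDerivAt (fun r => ψ r s y) (L t s y) t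
  ψs : ∀ t s y, HasDerivAt (fun r => ψ t r y) (X t s y) s
  ψy : ∀ t s y, HasDerivAt (fun r => ψ t s r) (Y t s y) y
  Lt : ∀ t s y, HasDerivAt (fun r => L r s y) (LL t s y) t
  Ls : ∀ t s y, HasDerivAt (fun r => L t r y) (LX t s y) s
  Ly : ∀ t s y, HasDerivAt (fun r => L t s r) (LY t s y) y
  Xt : ∀ t s y, HasDerivAt (fun r => X r s y) (LX t s y) t
  Xy : ∀ t s y, HasDerivAt (fun r => X t s r) (XY t s y) y
  Yt : ∀ t s y, HasDerivAt (fun r => Y r s y) (LY t s y) t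
  Ys : ∀ t s y, HasDerivAt (fun r => Y t r y) (XY t s y) s
  Yy : ∀ t s y, HasDerivAt (fun r => Y t s r) (YY t s y) y
  wave : ∀ t s y, LL t s y - 2 * LX t s y - YY t s y = -(|ψ t s y| ^ (p - 1) * ψ t s y)

/-- The potential energy density of the defocusing nonlinearity. -/
def potential (p z : ℝ) : ℝ := |z| ^ (p + 1) / (p + 1)

lemma potential_nonneg {p : ℝ} (hp : 1 < p) (z : ℝ) : 0 ≤ potential p z :=
  div_nonneg (rpow_nonneg (abs_nonneg z) _) (by linarith)

lemma continuous_potential {p : ℝ} (hp : 1 < p) : Continuous (potential p) :=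
  (continuous_abs.rpow_const fun _ => Or.inr (by linarith)).div_const _

lemma continuous_nonlinearity {p : ℝ} (hp : 1 < p) :
    Continuous fun z : ℝ => |z| ^ (p - 1) * z :=
  (continuous_abs.rpow_const fun _ => Or.inr (by linarith)).mul continuous_id

lemma hasDerivAt_potential {p : ℝ} (hp : 1 < p) (z : ℝ) :
    HasDerivAt (potential p) (|z| ^ (p - 1) * z) z := by
  refine ((hasDerivAt_abs_rpow z (p := p + 1) (by linarith)).div_const (p + 1)).congr_deriv ?_
  rw [show p + 1 - 2 = p - 1 by ring]
  have : p + 1 ≠ 0 := by linarith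
  field_simp

lemma nonlinearity_mul_self {p : ℝ} (hp : 1 < p) (z : ℝ) :
    |z| ^ (p - 1) * z * z = (p + 1) * potential p z := by
  have h1 : |z| ^ (p + 1) = |z| ^ (p - 1) * (z * z) := by
    rw [← abs_mul_abs_self z, show p + 1 = p - 1 + 1 + 1 by ring,
      rpow_add_one' (abs_nonneg z) (by linarith), rpow_add_one' (abs_nonneg z) (by linarith),
      mul_assoc]
  have : p + 1 ≠ 0 := by linarith
  rw [potential, h1]
  field_simp

variable {p : ℝ} {ψ L X Y LL LX LY XY YY : ℝ → ℝ → ℝ → ℝ}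

/-- Weighted bound for the energy flux through the null plane `x₁ = t`. -/
lemma NullFrame.energy_flux_le (F : NullFrame p ψ L X Y LL LX LY XY YY) (hp : 1 < p)
    {T N : ℝ} (hT : 0 ≤ T) (hN : 0 ≤ N) :
    ∫ t in 0..T, ∫ y in -(N + 1)..(N + 1), causalCutoff N t 0 y *
        (exp (-t) * (1 + t ^ 2 + y ^ 2) *
          ((L t 0 y ^ 2 + Y t 0 y ^ 2) / 2 + potential p (ψ t 0 y))) ≤
      ∫ s in 0..(N + 1), ∫ y in -(N + 1)..(N + 1), (1 + s ^ 2 + y ^ 2) *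
        (((L 0 s y - X 0 s y) ^ 2 + X 0 s y ^ 2 + Y 0 s y ^ 2) / 2 + potential p (ψ 0 s y)) := by
  have hN1 : N ≤ (N + 1) ^ 2 := by nlinarith
  have hV := continuous_potential hp
  have hn := continuous_nonlinearity hp
  have cV := hV.comp F.cψ
  have cn := hn.comp F.cψ
  simp only [Function.comp_def] at cV cn
  have := F.cL; have := F.cX; have := F.cY; have := F.cLL; have := F.cLX; have := F.cLY
  have := F.cXY; have := F.cYY
  set P : ℝ → ℝ → ℝ → ℝ := fun t s y =>
    ((L t s y - X t s y) ^ 2 + X t s y ^ 2 + Y t s y ^ 2) / 2 + potential p (ψ t s y) with hP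
  set A : ℝ → ℝ → ℝ → ℝ := fun t s y =>
    (L t s y ^ 2 + Y t s y ^ 2) / 2 + potential p (ψ t s y) with hA
  set C : ℝ → ℝ → ℝ → ℝ := fun t s y => -((L t s y - X t s y) * Y t s y) with hC
  set n : ℝ → ℝ → ℝ → ℝ := fun t s y => |ψ t s y| ^ (p - 1) * ψ t s y with hn'
  set Pt : ℝ → ℝ → ℝ → ℝ := fun t s y =>
    (L t s y - X t s y) * (LL t s y - LX t s y) + X t s y * LX t s y + Y t s y * LY t s y
      + n t s y * L t s y with hPt
  set As : ℝ → ℝ → ℝ → ℝ := fun t s y =>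
    L t s y * LX t s y + Y t s y * XY t s y + n t s y * X t s y with hAs
  set Cy : ℝ → ℝ → ℝ → ℝ := fun t s y =>
    -((LY t s y - XY t s y) * Y t s y + (L t s y - X t s y) * YY t s y) with hCy
  have Vt : ∀ t s y, HasDerivAt (fun r => potential p (ψ r s y)) (n t s y * L t s y) t :=
    fun t s y => (hasDerivAt_potential hp _).comp t (F.ψt t s y)
  have Vs : ∀ t s y, HasDerivAt (fun r => potential p (ψ t r y)) (n t s y * X t s y) s :=
    fun t s y => (hasDerivAt_potential hp _).comp s (F.ψs t s y)
  have dP : ∀ t s y, HasDerivAt (fun r => P r s y) (Pt t s y) t := fun t s y =>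
    ((((((F.Lt t s y).fun_sub (F.Xt t s y)).fun_pow 2).fun_add ((F.Xt t s y).fun_pow 2)).fun_add
      ((F.Yt t s y).fun_pow 2)).div_const 2).fun_add (Vt t s y) |>.congr_deriv
        (by simp only [hPt, hn']; push_cast; ring)
  have dA : ∀ t s y, HasDerivAt (fun r => A t r y) (As t s y) s := fun t s y =>
    ((((F.Ls t s y).fun_pow 2).fun_add ((F.Ys t s y).fun_pow 2)).div_const 2).fun_add (Vs t s y)
      |>.congr_deriv (by simp only [hAs, hn']; push_cast; ring)
  have dC : ∀ t s y, HasDerivAt (fun r => C t s r) (Cy t s y) y := fun t s y =>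
    (((F.Ly t s y).fun_sub (F.Xy t s y)).fun_mul (F.Yy t s y)).fun_neg
  have hPnn : ∀ t s y, 0 ≤ P t s y := fun t s y => by
    have := potential_nonneg hp (ψ t s y)
    simp only [hP]; positivity
  have eT : ∀ t : ℝ, HasDerivAt (fun r : ℝ => exp (-r)) (-exp (-t)) t := fun t =>
    ((hasDerivAt_neg t).exp).congr_deriv (by ring)
  have main := cutoff_energy_le (N := N) (T := T) (a := 0) (b := N + 1) (M := N + 1)
    (P := fun t s y => exp (-t) * (1 + (t + s) ^ 2 + y ^ 2) * P t s y)
    (A := fun t s y => exp (-t) * (1 + (t + s) ^ 2 + y ^ 2) * A t s y)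
    (C := fun t s y => exp (-t) * (1 + (t + s) ^ 2 + y ^ 2) * C t s y)
    (Pt := fun t s y => (-exp (-t) * (1 + (t + s) ^ 2 + y ^ 2) + exp (-t) * (2 * (t + s)))
      * P t s y + exp (-t) * (1 + (t + s) ^ 2 + y ^ 2) * Pt t s y)
    (As := fun t s y => exp (-t) * (2 * (t + s))
      * A t s y + exp (-t) * (1 + (t + s) ^ 2 + y ^ 2) * As t s y)
    (Cy := fun t s y => exp (-t) * (2 * y)
      * C t s y + exp (-t) * (1 + (t + s) ^ 2 + y ^ 2) * Cy t s y)
    hT (by linarith) (by linarith) hN1 (by fun_prop) (by fun_prop) (by fun_prop)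
    (by fun_prop) (by fun_prop) (by fun_prop)
    (fun t s _ y => ((eT t).fun_mul (((((hasDerivAt_id' t).add_const s).fun_pow 2).const_add
      1).add_const (y ^ 2))).fun_mul (dP t s y) |>.congr_deriv (by push_cast; ring))
    (fun t s _ y => ((((((hasDerivAt_id' s).const_add t).fun_pow 2).const_add
      1).add_const (y ^ 2)).const_mul (exp (-t))).fun_mul (dA t s y)
        |>.congr_deriv (by push_cast; ring))
    (fun t s _ y => ((((hasDerivAt_id' y).fun_pow 2).const_add
      (1 + (t + s) ^ 2)).const_mul (exp (-t))).fun_mul (dC t s y)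
        |>.congr_deriv (by push_cast; ring))
    ?_ ?_
  · have h0 : 0 ≤ ∫ s in 0..(N + 1), ∫ y in -(N + 1)..(N + 1), causalCutoff N T s y *
        (exp (-T) * (1 + (T + s) ^ 2 + y ^ 2) * P T s y) := by
      refine intervalIntegral.integral_nonneg (by linarith) fun s _ =>
        intervalIntegral.integral_nonneg (by linarith) fun y _ => ?_
      have := hPnn T s y
      have := causalCutoff_nonneg N T s y
      positivity
    have h1 : ∫ s in 0..(N + 1), ∫ y in -(N + 1)..(N + 1), causalCutoff N 0 s y *
        (exp (-0) * (1 + (0 + s) ^ 2 + y ^ 2) * P 0 s y) ≤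
        ∫ s in 0..(N + 1), ∫ y in -(N + 1)..(N + 1), (1 + s ^ 2 + y ^ 2) * P 0 s y := by
      have cχ := continuous_causalCutoff N
      have c1 : Continuous fun z : ℝ × ℝ => causalCutoff N 0 z.1 z.2 *
          (exp (-0) * (1 + (0 + z.1) ^ 2 + z.2 ^ 2) * P 0 z.1 z.2) := by
        have : Continuous fun q : ℝ × ℝ × ℝ => causalCutoff N q.1 q.2.1 q.2.2 *
          (exp (-q.1) * (1 + (q.1 + q.2.1) ^ 2 + q.2.2 ^ 2) * P q.1 q.2.1 q.2.2) := by fun_prop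
        exact this.comp (f := fun z : ℝ × ℝ => ((0 : ℝ), z.1, z.2)) (by fun_prop)
      have c2 : Continuous fun z : ℝ × ℝ => (1 + z.1 ^ 2 + z.2 ^ 2) * P 0 z.1 z.2 := by
        have : Continuous fun q : ℝ × ℝ × ℝ =>
          (1 + q.2.1 ^ 2 + q.2.2 ^ 2) * P q.1 q.2.1 q.2.2 := by fun_prop
        exact this.comp (f := fun z : ℝ × ℝ => ((0 : ℝ), z.1, z.2)) (by fun_prop)
      refine intervalIntegral.integral_mono_on (by linarith) (Continuous.intervalIntegrable
        (intervalIntegral.continuous_parametric_intervalIntegral_of_continuous' c1 _ _) _ _)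
        (Continuous.intervalIntegrable
        (intervalIntegral.continuous_parametric_intervalIntegral_of_continuous' c2 _ _) _ _)
        fun s _ => ?_
      refine intervalIntegral.integral_mono_on (by linarith)
        ((c1.comp (f := fun y : ℝ => (s, y)) (by fun_prop)).intervalIntegrable _ _)
        ((c2.comp (f := fun y : ℝ => (s, y)) (by fun_prop)).intervalIntegrable _ _) fun y _ => ?_
      have := hPnn 0 s y
      have h3 := causalCutoff_le_one N 0 s y
      simp only [neg_zero, exp_zero, one_mul, zero_add]
      exact mul_le_of_le_one_left (by positivity) h3
    have h2 : ∫ t in 0..T, ∫ y in -(N + 1)..(N + 1),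
        (causalCutoff N t (N + 1) y * (exp (-t) * (1 + (t + (N + 1)) ^ 2 + y ^ 2) * A t (N + 1) y)
          - causalCutoff N t 0 y * (exp (-t) * (1 + (t + 0) ^ 2 + y ^ 2) * A t 0 y)) =
        -∫ t in 0..T, ∫ y in -(N + 1)..(N + 1), causalCutoff N t 0 y *
        (exp (-t) * (1 + t ^ 2 + y ^ 2) * A t 0 y) := by
      rw [← intervalIntegral.integral_neg]
      refine intervalIntegral.integral_congr fun t ht => ?_
      rw [uIcc_of_le hT] at ht
      rw [← intervalIntegral.integral_neg]
      refine intervalIntegral.integral_congr fun y _ => ?_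
      rw [causalCutoff_eq_zero ht.1 (by nlinarith [ht.1, sq_nonneg y])]
      simp
    linarith
  · intro t _ s _ y
    have hw : Pt t s y = As t s y - Cy t s y := by
      simp only [hPt, hAs, hCy, hn']
      linear_combination (L t s y - X t s y) * F.wave t s y
    have hd : 0 ≤ (1 + (t + s) ^ 2 + y ^ 2) * P t s y - 2 * (t + s) * (P t s y - A t s y)
        - 2 * y * C t s y := by
      simp only [hP, hA, hC]
      have := potential_nonneg hp (ψ t s y)
      generalize potential p (ψ t s y) = v at *
      generalize hx : t + s = x
      have h1 : 0 ≤ (1 + x ^ 2 + y ^ 2) * v := by positivity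
      nlinarith [sq_nonneg ((L t s y - X t s y) * x + X t s y),
        sq_nonneg ((L t s y - X t s y) * y + Y t s y),
        sq_nonneg ((L t s y - X t s y) + x * X t s y + y * Y t s y),
        sq_nonneg (x * Y t s y - y * X t s y)]
    rw [hw]
    nlinarith [mul_nonneg (exp_pos (-t)).le hd]
  · intro t _ s _ y
    have hd : 0 ≤ (1 + (t + s) ^ 2 + y ^ 2) * P t s y + 2 * (t + s) * (P t s y - A t s y)
        + 2 * y * C t s y := by
      simp only [hP, hA, hC]
      have := potential_nonneg hp (ψ t s y)
      generalize potential p (ψ t s y) = v at *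
      generalize hx : t + s = x
      have h1 : 0 ≤ (1 + x ^ 2 + y ^ 2) * v := by positivity
      nlinarith [sq_nonneg ((L t s y - X t s y) * x - X t s y),
        sq_nonneg ((L t s y - X t s y) * y - Y t s y),
        sq_nonneg ((L t s y - X t s y) - x * X t s y - y * Y t s y),
        sq_nonneg (x * Y t s y - y * X t s y)]
    have h2 : 0 ≤ exp (-t) * (1 + (t + s) ^ 2 + y ^ 2) := by positivity
    nlinarith [mul_nonneg h2 hd]

end

section

variable {p : ℝ} {ψ L X Y LL LX LY XY YY : ℝ → ℝ → ℝ → ℝ}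

/-- The density `J^M` in terms of `u = t - x₁ + 1`, `y = x₂`, the value `z` of the solution, and its
derivatives `l = ∂ₜ + ∂₁`, `k = ∂ₜ - ∂₁`, `m = ∂₂`. -/
def nullDensity (p u y z l k m : ℝ) : ℝ :=
  1 / 2 * u ^ ((p - 5) / 2) * ((y * l + u * m) ^ 2 + (u * k + y * m + z) ^ 2
    + 2 / (p + 1) * (u ^ 2 + y ^ 2) * |z| ^ (p + 1))

lemma nullDensity_eq (p u y z l k m : ℝ) :
    nullDensity p u y z l k m = u ^ ((p - 5) / 2) * (((y * l + u * m) ^ 2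
      + (u * k + y * m + z) ^ 2) / 2 + (u ^ 2 + y ^ 2) * potential p z) := by
  rw [nullDensity, potential]; ring

/-- Localised form of the `J^M` energy estimate. -/
lemma NullFrame.cutoff_nullDensity_le (F : NullFrame p ψ L X Y LL LX LY XY YY) (hp : 1 < p)
    (hp5 : p < 5) {T N S : ℝ} (hT : 0 ≤ T) (hN : 0 ≤ N) (hS : T + N + 1 ≤ S) :
    ∫ s in -S..0, ∫ y in -S..S, causalCutoff N T s y *
        nullDensity p (1 - s) y (ψ T s y) (L T s y) (L T s y - 2 * X T s y) (Y T s y) ≤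
      (∫ s in -S..0, ∫ y in -S..S, causalCutoff N 0 s y *
        nullDensity p (1 - s) y (ψ 0 s y) (L 0 s y) (L 0 s y - 2 * X 0 s y) (Y 0 s y)) +
      ∫ t in 0..T, ∫ y in -S..S, causalCutoff N t 0 y *
        ((y * L t 0 y + Y t 0 y) ^ 2 + 2 / (p + 1) * |ψ t 0 y| ^ (p + 1)) := by
  have hS0 : 0 ≤ S := by linarith
  have hSN : N ≤ S ^ 2 := by nlinarith
  have hV := continuous_potential hp
  have hn := continuous_nonlinearity hp
  have cV := hV.comp F.cψ
  have cn := hn.comp F.cψ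
  simp only [Function.comp_def] at cV cn
  have := F.cψ; have := F.cL; have := F.cX; have := F.cY; have := F.cLL; have := F.cLX
  have := F.cLY; have := F.cXY; have := F.cYY
  set a : ℝ := (p - 5) / 2 with ha
  set w : ℝ → ℝ := fun s => (max (1 - s) (1 / 2)) ^ a with hw
  set w' : ℝ → ℝ := fun s => -(a * (max (1 - s) (1 / 2)) ^ (a - 1)) with hw'
  have hpos : ∀ s : ℝ, max (1 - s) (1 / 2) ≠ 0 := fun s =>
    (lt_of_lt_of_le (by norm_num) (le_max_right _ _)).ne'
  have cmax : Continuous fun s : ℝ => max (1 - s) (1 / 2) := by fun_prop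
  have cw : Continuous w := cmax.rpow_const fun s => Or.inl (hpos s)
  have cw' : Continuous w' := ((cmax.rpow_const fun s => Or.inl (hpos s)).const_mul a).neg
  have wval : ∀ s ≤ 0, w s = (1 - s) ^ a := fun s hs => by
    simp only [hw]; rw [max_eq_left (by linarith)]
  have hw_val : ∀ s ≤ 0, w' s = -(a * (1 - s) ^ (a - 1)) := fun s hs => by
    simp only [hw']; rw [max_eq_left (by linarith)]
  have dw : ∀ s ≤ 0, HasDerivAt w (w' s) s := fun s hs => by
    have h1 : HasDerivAt (fun r : ℝ => (1 - r) ^ a) (w' s) s := by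
      refine (((hasDerivAt_id' s).const_sub 1).rpow_const (p := a)
        (Or.inl (by linarith))).congr_deriv ?_
      rw [hw_val s hs]; ring
    refine h1.congr_of_eventuallyEq ?_
    filter_upwards [Iio_mem_nhds (show s < 1 / 2 by linarith)] with r hr
    simp only [hw]; rw [max_eq_left (by linarith [mem_Iio.mp hr])]
  set n : ℝ → ℝ → ℝ → ℝ := fun t s y => |ψ t s y| ^ (p - 1) * ψ t s y with hn'
  set V : ℝ → ℝ → ℝ → ℝ := fun t s y => potential p (ψ t s y) with hVdef
  set f : ℝ → ℝ → ℝ → ℝ := fun t s y =>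
    (1 - s) * (L t s y - 2 * X t s y) + y * Y t s y + ψ t s y with hf
  set g : ℝ → ℝ → ℝ → ℝ := fun t s y => y * L t s y + (1 - s) * Y t s y with hg
  set ft : ℝ → ℝ → ℝ → ℝ := fun t s y =>
    (1 - s) * (LL t s y - 2 * LX t s y) + y * LY t s y + L t s y with hft
  set fy : ℝ → ℝ → ℝ → ℝ := fun t s y =>
    (1 - s) * (LY t s y - 2 * XY t s y) + (Y t s y + y * YY t s y) + Y t s y with hfy
  set gt : ℝ → ℝ → ℝ → ℝ := fun t s y => y * LL t s y + (1 - s) * LY t s y with hgt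
  set gs : ℝ → ℝ → ℝ → ℝ := fun t s y =>
    y * LX t s y + (-Y t s y + (1 - s) * XY t s y) with hgs
  set gy : ℝ → ℝ → ℝ → ℝ := fun t s y =>
    (L t s y + y * LY t s y) + (1 - s) * YY t s y with hgy
  have Vt : ∀ t s y, HasDerivAt (fun r => V r s y) (n t s y * L t s y) t :=
    fun t s y => (hasDerivAt_potential hp _).comp t (F.ψt t s y)
  have Vs : ∀ t s y, HasDerivAt (fun r => V t r y) (n t s y * X t s y) s :=
    fun t s y => (hasDerivAt_potential hp _).comp s (F.ψs t s y)
  have Vy : ∀ t s y, HasDerivAt (fun r => V t s r) (n t s y * Y t s y) y :=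
    fun t s y => (hasDerivAt_potential hp _).comp y (F.ψy t s y)
  have du : ∀ s : ℝ, HasDerivAt (fun r : ℝ => 1 - r) (-1) s := fun s =>
    (hasDerivAt_id' s).const_sub 1
  have dft : ∀ t s y, HasDerivAt (fun r => f r s y) (ft t s y) t := fun t s y =>
    (((((F.Lt t s y).fun_sub ((F.Xt t s y).const_mul 2)).const_mul (1 - s)).fun_add
      ((F.Yt t s y).const_mul y)).fun_add (F.ψt t s y))
  have dfy : ∀ t s y, HasDerivAt (fun r => f t s r) (fy t s y) y := fun t s y =>
    (((((F.Ly t s y).fun_sub ((F.Xy t s y).const_mul 2)).const_mul (1 - s)).fun_add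
      ((hasDerivAt_id' y).fun_mul (F.Yy t s y))).fun_add (F.ψy t s y)).congr_deriv
        (by simp only [hfy]; ring)
  have dgt : ∀ t s y, HasDerivAt (fun r => g r s y) (gt t s y) t := fun t s y =>
    ((F.Lt t s y).const_mul y).fun_add ((F.Yt t s y).const_mul (1 - s))
  have dgs : ∀ t s y, HasDerivAt (fun r => g t r y) (gs t s y) s := fun t s y =>
    (((F.Ls t s y).const_mul y).fun_add ((du s).fun_mul (F.Ys t s y))).congr_deriv
      (by simp only [hgs]; ring)
  have dgy : ∀ t s y, HasDerivAt (fun r => g t s r) (gy t s y) y := fun t s y =>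
    (((hasDerivAt_id' y).fun_mul (F.Ly t s y)).fun_add ((F.Yy t s y).const_mul (1 - s))).congr_deriv
      (by simp only [hgy]; ring)
  have main := cutoff_energy_le (N := N) (T := T) (a := -S) (b := 0) (M := S)
    (P := fun t s y => w s * ((g t s y ^ 2 + f t s y ^ 2) / 2
      + ((1 - s) ^ 2 + y ^ 2) * V t s y))
    (A := fun t s y => w s * (g t s y ^ 2 + 2 * (1 - s) ^ 2 * V t s y))
    (C := fun t s y => w s * (-(f t s y * g t s y) + 2 * (1 - s) * y * V t s y))
    (Pt := fun t s y => w s * (g t s y * gt t s y + f t s y * ft t s y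
      + ((1 - s) ^ 2 + y ^ 2) * (n t s y * L t s y)))
    (As := fun t s y => w' s * (g t s y ^ 2 + 2 * (1 - s) ^ 2 * V t s y)
      + w s * (2 * g t s y * gs t s y + (-4 * (1 - s) * V t s y
        + 2 * (1 - s) ^ 2 * (n t s y * X t s y))))
    (Cy := fun t s y => w s * (-(fy t s y * g t s y + f t s y * gy t s y)
      + (2 * (1 - s) * V t s y + 2 * (1 - s) * y * (n t s y * Y t s y))))
    hT (by linarith) hS0 hSN (by fun_prop) (by fun_prop) (by fun_prop)
    (by fun_prop) (by fun_prop) (by fun_prop)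
    (fun t s _ y => ((((dgt t s y).fun_pow 2).fun_add ((dft t s y).fun_pow 2)).div_const 2).fun_add
      ((Vt t s y).const_mul ((1 - s) ^ 2 + y ^ 2)) |>.const_mul (w s) |>.congr_deriv
        (by push_cast; ring))
    (fun t s hs y => (dw s hs.2).fun_mul (((dgs t s y).fun_pow 2).fun_add
      ((((du s).fun_pow 2).const_mul 2).fun_mul (Vs t s y))) |>.congr_deriv (by push_cast; ring))
    (fun t s _ y => ((((dfy t s y).fun_mul (dgy t s y)).fun_neg).fun_add
      (((hasDerivAt_id' y).const_mul (2 * (1 - s))).fun_mul (Vy t s y))).const_mul (w s)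
        |>.congr_deriv (by ring))
    ?_ ?_
  · have e1 : ∀ t, ∫ s in -S..0, ∫ y in -S..S, causalCutoff N t s y *
        (w s * ((g t s y ^ 2 + f t s y ^ 2) / 2 + ((1 - s) ^ 2 + y ^ 2) * V t s y)) =
        ∫ s in -S..0, ∫ y in -S..S, causalCutoff N t s y *
        nullDensity p (1 - s) y (ψ t s y) (L t s y) (L t s y - 2 * X t s y) (Y t s y) := by
      intro t
      refine intervalIntegral.integral_congr fun s hs =>
        intervalIntegral.integral_congr fun y _ => ?_
      rw [uIcc_of_le (by linarith)] at hs
      simp only [nullDensity_eq, wval s hs.2, hg, hf, hVdef, ha]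
    have e2 : ∫ t in 0..T, ∫ y in -S..S,
        (causalCutoff N t 0 y * (w 0 * (g t 0 y ^ 2 + 2 * (1 - 0) ^ 2 * V t 0 y))
          - causalCutoff N t (-S) y *
            (w (-S) * (g t (-S) y ^ 2 + 2 * (1 - -S) ^ 2 * V t (-S) y))) =
        ∫ t in 0..T, ∫ y in -S..S, causalCutoff N t 0 y *
        ((y * L t 0 y + Y t 0 y) ^ 2 + 2 / (p + 1) * |ψ t 0 y| ^ (p + 1)) := by
      refine intervalIntegral.integral_congr fun t ht =>
        intervalIntegral.integral_congr fun y _ => ?_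
      rw [uIcc_of_le hT] at ht
      rw [causalCutoff_eq_zero (s := -S) ht.1 (by nlinarith [ht.1, ht.2, sq_nonneg y]),
        wval 0 le_rfl]
      simp only [hg, hVdef, potential, sub_zero, one_rpow]
      ring
    rw [e1, e1, e2] at main
    exact main
  · intro t _ s hs y
    have hu : 0 < 1 - s := by linarith [hs.2]
    have hk : w s = (1 - s) * (1 - s) ^ (a - 1) := by
      rw [wval s hs.2, mul_comm, ← rpow_add_one hu.ne', sub_add_cancel]
    have hk0 : 0 ≤ (1 - s) ^ (a - 1) := rpow_nonneg hu.le _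
    rw [hw_val s hs.2, hk]
    generalize (1 - s) ^ (a - 1) = k at *
    have hE := F.wave t s y
    have hnV : n t s y * ψ t s y = (p + 1) * V t s y := nonlinearity_mul_self hp _
    have hbulk : a * k * g t s y ^ 2 ≤ 0 := by
      have : 0 ≤ k * g t s y ^ 2 := by positivity
      have : a ≤ 0 := by rw [ha]; linarith
      nlinarith
    refine sub_nonpos.mp (le_trans (le_of_eq ?_) hbulk)
    change _ = - n t s y at hE
    simp only [hft, hfy, hgt, hgs, hgy, ha]
    simp only [hf, hg]
    generalize hvv : V t s y = v at *
    generalize hnn : n t s y = m at *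
    linear_combination (1 - s) * k * (y * (y * L t s y + (1 - s) * Y t s y)
      + (1 - s) * ((1 - s) * (L t s y - 2 * X t s y) + y * Y t s y + ψ t s y)) * hE
      - (1 - s) ^ 2 * k * hnV
  · intro t _ s hs y
    have hu : 0 < 1 - s := by linarith [hs.2]
    have hw0 : 0 ≤ w s := by rw [wval s hs.2]; exact rpow_nonneg hu.le _
    have hv : 0 ≤ V t s y := potential_nonneg hp _
    generalize hff : f t s y = f' at *
    generalize hgg : g t s y = g' at *
    generalize hvv : V t s y = v at *
    generalize hx : t + s = x
    generalize hu' : 1 - s = u at *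
    have h1 : 0 ≤ ((1 + x) * f' - y * g') ^ 2 + ((1 - x) * g' - y * f') ^ 2 := by positivity
    have h2 : 0 ≤ v * (((1 + x) * y + y * u) ^ 2 + ((1 - x) * u + y * y) ^ 2) := by positivity
    have h3 := mul_nonneg hw0 (add_nonneg (mul_nonneg (by norm_num : (0:ℝ) ≤ 1 / 2) h1) h2)
    refine h3.trans (le_of_eq ?_)
    ring

end

lemma mul_sq_le_of_forall_two_mul {z I : ℝ} (hI : 0 ≤ I)
    (h : ∀ l : ℝ, 0 < l → 2 * l * |z| ≤ l ^ 2 + I) : z ^ 2 ≤ I := by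
  rcases eq_or_ne z 0 with rfl | hz
  · simpa using hI
  · have := h |z| (abs_pos.mpr hz)
    nlinarith [sq_abs z]

/-- A one-dimensional Hardy inequality on a half-line, truncated. -/
lemma hardy_half_line {f f' : ℝ → ℝ} {q : ℝ} (hq : 0 < q) (hd : ∀ y, HasDerivAt f (f' y) y)
    (hc : Continuous f') (h2 : IntegrableOn (fun y => (y * f' y) ^ 2) (Ioi 0))
    (hf : IntegrableOn (fun y => |f y| ^ q) (Ioi 0)) {Y : ℝ} (hY : 0 < Y) :
    ∫ y in 0..Y, f y ^ 2 ≤ 6 * ∫ y in Ioi 0, (y * f' y) ^ 2 := by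
  set I : ℝ := ∫ y in Ioi 0, (y * f' y) ^ 2 with hI
  have hI0 : 0 ≤ I := setIntegral_nonneg measurableSet_Ioi fun y _ => sq_nonneg _
  have hcf : Continuous f := continuous_iff_continuousAt.2 fun y => (hd y).continuousAt
  have hsub : Ioi Y ⊆ Ioi 0 := Ioi_subset_Ioi hY.le
  have hpow : IntegrableOn (fun y : ℝ => y ^ (-2 : ℝ)) (Ioi Y) :=
    integrableOn_Ioi_rpow_of_lt (by norm_num) hY
  have hpowI : ∫ y in Ioi Y, y ^ (-2 : ℝ) = 1 / Y := by
    rw [integral_Ioi_rpow_of_lt (by norm_num) hY]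
    norm_num
    rw [rpow_neg_one]
  have hpt : ∀ l : ℝ, 0 < l → ∀ y ∈ Ioi Y,
      2 * l * |f' y| ≤ l ^ 2 * y ^ (-2 : ℝ) + (y * f' y) ^ 2 := by
    intro l hl y hy
    have hy0 : 0 < y := hY.trans hy
    have e : y ^ (-2 : ℝ) = (y⁻¹) ^ 2 := by
      rw [rpow_neg hy0.le, ← inv_rpow hy0.le]; norm_cast
    rw [e]
    have h1 : y⁻¹ * y = 1 := inv_mul_cancel₀ hy0.ne'
    have h3 := sq_nonneg (l * y⁻¹ - y * |f' y|)
    have h4 : l * y⁻¹ * (y * |f' y|) = l * |f' y| := by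
      linear_combination l * |f' y| * h1
    have h5 : (y * f' y) ^ 2 = (y * |f' y|) ^ 2 := by rw [mul_pow, mul_pow, sq_abs]
    rw [h5]
    linear_combination h3 - 2 * h4
  have hmaj : ∀ l : ℝ, IntegrableOn (fun y => l ^ 2 * y ^ (-2 : ℝ) + (y * f' y) ^ 2) (Ioi Y) :=
    fun l => (hpow.const_mul _).add (h2.mono_set hsub)
  have hint : IntegrableOn f' (Ioi Y) := by
    refine Integrable.mono' (hpow.add (h2.mono_set hsub)) hc.aestronglyMeasurable ?_
    refine (ae_restrict_mem measurableSet_Ioi).mono fun y hy => ?_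
    have := hpt 1 one_pos y hy
    simp only [Pi.add_apply, norm_eq_abs]
    linarith [abs_nonneg (f' y)]
  have hlim : Tendsto f atTop (nhds 0) := by
    have h1 := tendsto_limUnder_of_hasDerivAt_of_integrableOn_Ioi (fun y _ => hd y) hint
    have h3 : Tendsto (fun y => |f y| ^ q) atTop (nhds (|limUnder atTop f| ^ q)) :=
      h1.abs.rpow_const (Or.inr hq.le)
    have h4 : |limUnder atTop f| ^ q = 0 := by
      refine IntegrableAtFilter.eq_zero_of_tendsto (μ := volume) ⟨Ioi 0, Ioi_mem_atTop 0, hf⟩ ?_ h3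
      intro s hs
      obtain ⟨b, hb⟩ := mem_atTop_sets.1 hs
      rw [← top_le_iff, ← volume_Ici (a := b)]
      exact measure_mono hb
    have h5 : limUnder atTop f = 0 := by
      rwa [rpow_eq_zero (abs_nonneg _) hq.ne', abs_eq_zero] at h4
    rwa [h5] at h1
  have hval : ∫ y in Ioi Y, f' y = 0 - f Y :=
    integral_Ioi_of_hasDerivAt_of_tendsto hcf.continuousWithinAt (fun y _ => hd y) hint hlim
  have hbd : ∀ l : ℝ, 0 < l → 2 * l * |f Y| ≤ l ^ 2 * (1 / Y) + I := by
    intro l hl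
    have h1 : |f Y| ≤ ∫ y in Ioi Y, |f' y| := by
      have := norm_integral_le_integral_norm (μ := volume.restrict (Ioi Y)) f'
      rw [hval] at this
      simpa using this
    calc 2 * l * |f Y| ≤ 2 * l * ∫ y in Ioi Y, |f' y| := by gcongr
      _ = ∫ y in Ioi Y, 2 * l * |f' y| := (integral_const_mul _ _).symm
      _ ≤ ∫ y in Ioi Y, (l ^ 2 * y ^ (-2 : ℝ) + (y * f' y) ^ 2) :=
        setIntegral_mono_on (hint.abs.const_mul _) (hmaj l) measurableSet_Ioi (hpt l hl)
      _ = l ^ 2 * (1 / Y) + ∫ y in Ioi Y, (y * f' y) ^ 2 := by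
        rw [integral_add (hpow.const_mul _) (h2.mono_set hsub), integral_const_mul, hpowI]
      _ ≤ _ := by
        gcongr
        exact setIntegral_mono_set h2 (Eventually.of_forall fun y => sq_nonneg _)
          (Eventually.of_forall hsub)
  have hYf : Y * f Y ^ 2 ≤ I := by
    have hs := sq_sqrt hY.le
    have hs0 := sqrt_pos.mpr hY
    have : (√Y * f Y) ^ 2 ≤ I := by
      refine mul_sq_le_of_forall_two_mul hI0 fun l hl => ?_
      have h1 := hbd (l * √Y) (by positivity)
      rw [mul_pow, hs] at h1
      rw [abs_mul, abs_of_pos hs0]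
      have h3 : l ^ 2 * Y * (1 / Y) = l ^ 2 := by field_simp
      linarith
    rwa [mul_pow, hs] at this
  have hftc : ∫ y in 0..Y, (f y ^ 2 + y * (2 * f y * f' y)) = Y * f Y ^ 2 := by
    rw [intervalIntegral.integral_eq_sub_of_hasDerivAt (f := fun y => y * f y ^ 2)
      (fun y _ => ((hasDerivAt_id' y).fun_mul ((hd y).fun_pow 2)).congr_deriv (by push_cast; ring))
      (Continuous.intervalIntegrable (by fun_prop) _ _)]
    ring
  have h6 : ∫ y in 0..Y, (1 / 2 * f y ^ 2 - 2 * (y * f' y) ^ 2) ≤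
      ∫ y in 0..Y, (f y ^ 2 + y * (2 * f y * f' y)) := by
    refine intervalIntegral.integral_mono_on hY.le (Continuous.intervalIntegrable (by fun_prop) _ _)
      (Continuous.intervalIntegrable (by fun_prop) _ _) fun y _ => ?_
    nlinarith [sq_nonneg (f y + 2 * (y * f' y))]
  rw [hftc, intervalIntegral.integral_sub (Continuous.intervalIntegrable (by fun_prop) _ _)
    (Continuous.intervalIntegrable (by fun_prop) _ _), intervalIntegral.integral_const_mul,
    intervalIntegral.integral_const_mul] at h6
  have h7 : ∫ y in 0..Y, (y * f' y) ^ 2 ≤ I := by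
    rw [intervalIntegral.integral_of_le hY.le]
    exact setIntegral_mono_set h2 (Eventually.of_forall fun y => sq_nonneg _)
      (Eventually.of_forall Ioc_subset_Ioi_self)
  linarith

/-- A one-dimensional Hardy inequality. -/
lemma hardy_line {f f' : ℝ → ℝ} {q : ℝ} (hq : 0 < q) (hd : ∀ y, HasDerivAt f (f' y) y)
    (hc : Continuous f') (h2 : Integrable fun y => (y * f' y) ^ 2)
    (hf : Integrable fun y => |f y| ^ q) :
    Integrable (fun y => f y ^ 2) ∧ ∫ y, f y ^ 2 ≤ 12 * ∫ y, (y * f' y) ^ 2 := by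
  have hcf : Continuous f := continuous_iff_continuousAt.2 fun y => (hd y).continuousAt
  have hmono : ∫ y in Ioi 0, (y * f' y) ^ 2 ≤ ∫ y, (y * f' y) ^ 2 :=
    setIntegral_le_integral h2 (Eventually.of_forall fun y => sq_nonneg _)
  have hb : ∀ n : ℕ, ∫ y in -((n : ℝ) + 1)..((n : ℝ) + 1), f y ^ 2 ≤
      12 * ∫ y, (y * f' y) ^ 2 := by
    intro n
    have hn : (0 : ℝ) < n + 1 := by positivity
    have hpos := hardy_half_line hq hd hc h2.integrableOn hf.integrableOn hn
    have hneg := hardy_half_line (f := fun y => f (-y)) (f' := fun y => -f' (-y)) hq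
      (fun y => ((hd (-y)).comp y (hasDerivAt_neg y)).congr_deriv (by ring))
      (by fun_prop) (by simpa using h2.comp_neg.integrableOn) hf.comp_neg.integrableOn hn
    have e1 : ∫ y in 0..((n : ℝ) + 1), f (-y) ^ 2 = ∫ y in -((n : ℝ) + 1)..0, f y ^ 2 := by
      simpa using intervalIntegral.integral_comp_neg (a := 0) (b := (n : ℝ) + 1)
        (fun y => f y ^ 2)
    have e2 : ∫ y in Ioi 0, (y * -f' (-y)) ^ 2 ≤ ∫ y, (y * f' y) ^ 2 := by
      have e3 : ∫ y, (y * -f' (-y)) ^ 2 = ∫ y, (y * f' y) ^ 2 := by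
        rw [← integral_neg_eq_self (fun y => (y * f' y) ^ 2)]
        simp
      rw [← e3]
      refine setIntegral_le_integral ?_ (Eventually.of_forall fun y => sq_nonneg _)
      simpa using h2.comp_neg
    rw [e1] at hneg
    rw [← intervalIntegral.integral_add_adjacent_intervals (b := 0)
      (Continuous.intervalIntegrable (by fun_prop) _ _)
      (Continuous.intervalIntegrable (by fun_prop) _ _)]
    linarith
  have tb : Tendsto (fun n : ℕ => (n : ℝ) + 1) atTop atTop :=
    tendsto_atTop_add_const_right _ _ tendsto_natCast_atTop_atTop
  have ta : Tendsto (fun n : ℕ => -((n : ℝ) + 1)) atTop atBot := tendsto_neg_atTop_atBot.comp tb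
  have hint : Integrable (fun y => f y ^ 2) := by
    refine integrable_of_intervalIntegral_norm_bounded (12 * ∫ y, (y * f' y) ^ 2)
      (fun n => (Continuous.integrableOn_Icc (by fun_prop)).mono_set Ioc_subset_Icc_self) ta tb
      (Eventually.of_forall fun n => ?_)
    simpa using hb n
  exact ⟨hint, le_of_tendsto (intervalIntegral_tendsto_integral hint ta tb)
    (Eventually.of_forall hb)⟩

/-- The Hardy inequality in the second variable, in the plane. -/
lemma hardy_plane {f f' : ℝ → ℝ → ℝ} {q : ℝ} (hq : 0 < q)
    (hd : ∀ s y, HasDerivAt (f s) (f' s y) y)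
    (hcf : Continuous fun z : ℝ × ℝ => f z.1 z.2) (hc : Continuous fun z : ℝ × ℝ => f' z.1 z.2)
    (h2 : Integrable fun z : ℝ × ℝ => (z.2 * f' z.1 z.2) ^ 2)
    (hf : Integrable fun z : ℝ × ℝ => |f z.1 z.2| ^ q) :
    Integrable fun z : ℝ × ℝ => f z.1 z.2 ^ 2 := by
  have key : ∀ᵐ s, Integrable (fun y => f s y ^ 2) ∧
      ∫ y, f s y ^ 2 ≤ 12 * ∫ y, (y * f' s y) ^ 2 := by
    filter_upwards [h2.prod_right_ae, hf.prod_right_ae] with s hs1 hs2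
    exact hardy_line hq (hd s) (hc.comp (f := fun y : ℝ => (s, y)) (by fun_prop)) hs1 hs2
  have hm : AEStronglyMeasurable (fun z : ℝ × ℝ => f z.1 z.2 ^ 2) (volume.prod volume) :=
    (hcf.pow 2).aestronglyMeasurable
  refine (integrable_prod_iff hm).2 ⟨key.mono fun s hs => hs.1, ?_⟩
  refine Integrable.mono' (h2.integral_prod_left.const_mul 12)
    hm.norm.integral_prod_right' (key.mono fun s hs => ?_)
  simp only [norm_pow, norm_eq_abs, sq_abs]
  rw [abs_of_nonneg (integral_nonneg fun y => sq_nonneg _)]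
  exact hs.2

section

lemma mkE_eq (a b : ℝ) :
    mkE a b = a • EuclideanSpace.single (0 : Fin 2) (1 : ℝ) +
      b • EuclideanSpace.single (1 : Fin 2) (1 : ℝ) := by
  ext i
  fin_cases i <;> simp [mkE]

@[simp] lemma mkE_apply_zero (a b : ℝ) : mkE a b 0 = a := by simp [mkE]

@[simp] lemma mkE_apply_one (a b : ℝ) : mkE a b 1 = b := by simp [mkE]

lemma norm_sq_mkE (a b : ℝ) : ‖mkE a b‖ ^ 2 = a ^ 2 + b ^ 2 := by
  simp [EuclideanSpace.norm_sq_eq]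

lemma continuous_mkE : Continuous fun z : ℝ × ℝ => mkE z.1 z.2 := by
  simp only [mkE_eq]
  fun_prop

/-- The unit vector `∂₁` of space-time. -/
def dirOne : ℝ × E2 := (0, EuclideanSpace.single 0 1)

/-- The unit vector `∂₂` of space-time. -/
def dirTwo : ℝ × E2 := (0, EuclideanSpace.single 1 1)

/-- The unit vector `∂ₜ` of space-time. -/
def dirTime : ℝ × E2 := (1, 0)

/-- The space-time point with null coordinates `(t, x₁ - t, x₂) = (t, s, y)`. -/
def nullPoint (t s y : ℝ) : ℝ × E2 := (t, mkE (t + s) y)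

lemma continuous_nullPoint :
    Continuous fun q : ℝ × ℝ × ℝ => nullPoint q.1 q.2.1 q.2.2 := by
  unfold nullPoint
  simp only [mkE_eq]
  fun_prop

lemma hasDerivAt_nullPoint_fst (t s y : ℝ) :
    HasDerivAt (fun r => nullPoint r s y) (dirTime + dirOne) t := by
  have h : HasDerivAt (fun r : ℝ => r + s) 1 t := (hasDerivAt_id' t).add_const s
  have h2 := (hasDerivAt_id' t).prodMk
    ((h.smul_const (EuclideanSpace.single (0 : Fin 2) (1 : ℝ))).add_const
      (y • EuclideanSpace.single (1 : Fin 2) (1 : ℝ)))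
  simp only [nullPoint, mkE_eq]
  refine h2.congr_deriv ?_
  simp [dirTime, dirOne]

lemma hasDerivAt_nullPoint_snd (t s y : ℝ) :
    HasDerivAt (fun r => nullPoint t r y) dirOne s := by
  have h : HasDerivAt (fun r : ℝ => t + r) 1 s := (hasDerivAt_id' s).const_add t
  have h2 := (hasDerivAt_const s t).prodMk
    ((h.smul_const (EuclideanSpace.single (0 : Fin 2) (1 : ℝ))).add_const
      (y • EuclideanSpace.single (1 : Fin 2) (1 : ℝ)))
  simp only [nullPoint, mkE_eq]
  refine h2.congr_deriv ?_
  simp [dirOne]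

lemma hasDerivAt_nullPoint_thd (t s y : ℝ) :
    HasDerivAt (fun r => nullPoint t s r) dirTwo y := by
  have h2 := (hasDerivAt_const y t).prodMk
    (((hasDerivAt_id' y).smul_const (EuclideanSpace.single (1 : Fin 2) (1 : ℝ))).const_add
      ((t + s) • EuclideanSpace.single (0 : Fin 2) (1 : ℝ)))
  simp only [nullPoint, mkE_eq]
  refine h2.congr_deriv ?_
  simp [dirTwo]

/-- The directional derivative of a function on space-time. -/
def dirDeriv (v : ℝ × E2) (f : ℝ × E2 → ℝ) (q : ℝ × E2) : ℝ := fderiv ℝ f q v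

lemma dirDeriv_add (v w : ℝ × E2) (f : ℝ × E2 → ℝ) (q : ℝ × E2) :
    dirDeriv (v + w) f q = dirDeriv v f q + dirDeriv w f q := map_add _ v w

variable {f : ℝ × E2 → ℝ}

lemma contDiff_dirDeriv (hf : ContDiff ℝ (⊤ : ℕ∞) f) (v : ℝ × E2) :
    ContDiff ℝ (⊤ : ℕ∞) (dirDeriv v f) :=
  (hf.fderiv_right (m := (⊤ : ℕ∞)) (by simp)).clm_apply contDiff_const

lemma dirDeriv_comm (hf : ContDiff ℝ (⊤ : ℕ∞) f) (v w q : ℝ × E2) :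
    dirDeriv v (dirDeriv w f) q = dirDeriv w (dirDeriv v f) q := by
  have h1 : Differentiable ℝ (fderiv ℝ f) :=
    (hf.fderiv_right (m := (⊤ : ℕ∞)) (by simp)).differentiable (by simp)
  have h2 : ∀ v w, dirDeriv v (dirDeriv w f) q = fderiv ℝ (fderiv ℝ f) q v w := by
    intro v w
    have : dirDeriv w f = fun q => fderiv ℝ f q w := rfl
    rw [this, dirDeriv, fderiv_clm_apply (h1 q) (differentiableAt_const w)]
    simp
  have h3 : minSmoothness ℝ 2 ≤ ((⊤ : ℕ∞) : WithTop ℕ∞) := by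
    rw [minSmoothness_of_isRCLikeNormedField]
    exact WithTop.coe_le_coe.2 (le_top : (2 : ℕ∞) ≤ ⊤)
  rw [h2, h2]
  exact (hf.contDiffAt.isSymmSndFDerivAt h3).eq v w

lemma hasDerivAt_comp_curve (hf : ContDiff ℝ (⊤ : ℕ∞) f) {c : ℝ → ℝ × E2} {v : ℝ × E2} {r : ℝ}
    (hc : HasDerivAt c v r) : HasDerivAt (fun r => f (c r)) (dirDeriv v f (c r)) r :=
  ((hf.differentiable (by simp)) (c r)).hasFDerivAt.comp_hasDerivAt r hc

lemma continuous_comp_nullPoint (hf : ContDiff ℝ (⊤ : ℕ∞) f) :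
    Continuous fun q : ℝ × ℝ × ℝ => f (nullPoint q.1 q.2.1 q.2.2) :=
  hf.continuous.comp continuous_nullPoint

lemma deriv_slice_eq_dirDeriv (hf : ContDiff ℝ (⊤ : ℕ∞) f) (t : ℝ) (x : E2) :
    deriv (fun s => f (s, x)) t = dirDeriv dirTime f (t, x) :=
  (hasDerivAt_comp_curve hf ((hasDerivAt_id' t).prodMk (hasDerivAt_const t x))).deriv

lemma pdx_slice_eq_dirDeriv (hf : ContDiff ℝ (⊤ : ℕ∞) f) (t : ℝ) (x : E2) (i : Fin 2) :
    pdx i (fun x => f (t, x)) x = dirDeriv (0, EuclideanSpace.single i 1) f (t, x) := by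
  have h1 : HasFDerivAt (fun x : E2 => (t, x)) (ContinuousLinearMap.inr ℝ ℝ E2) x :=
    hasFDerivAt_prodMk_right t x
  have h := ((hf.differentiable (by simp)) (t, x)).hasFDerivAt.comp x h1
  rw [pdx, show (fun x => f (t, x)) = f ∘ fun x => (t, x) from rfl, h.fderiv]
  simp [dirDeriv]

/-- A smooth solution of the wave equation, expressed in null coordinates. -/
lemma nullFrame_of_isWaveSolR2 {p : ℝ} {φ : ℝ → E2 → ℝ}
    (hsm : ContDiff ℝ (⊤ : ℕ∞) (fun q : ℝ × E2 => φ q.1 q.2)) (hsol : IsWaveSolR2 p φ) :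
    ∃ LL LX LY XY YY, NullFrame p (fun t s y => φ t (mkE (t + s) y))
      (fun t s y => pt φ t (mkE (t + s) y) + pdx 0 (φ t) (mkE (t + s) y))
      (fun t s y => pdx 0 (φ t) (mkE (t + s) y)) (fun t s y => pdx 1 (φ t) (mkE (t + s) y))
      LL LX LY XY YY := by
  set f : ℝ × E2 → ℝ := fun q => φ q.1 q.2 with hf
  have d := contDiff_dirDeriv hsm
  have ept : ∀ t x, pt φ t x = dirDeriv dirTime f (t, x) := deriv_slice_eq_dirDeriv hsm
  have e1 : ∀ t x, pdx 0 (φ t) x = dirDeriv dirOne f (t, x) :=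
    fun t x => pdx_slice_eq_dirDeriv hsm t x 0
  have e2 : ∀ t x, pdx 1 (φ t) x = dirDeriv dirTwo f (t, x) :=
    fun t x => pdx_slice_eq_dirDeriv hsm t x 1
  have eL : (fun t s y => pt φ t (mkE (t + s) y) + pdx 0 (φ t) (mkE (t + s) y)) =
      fun t s y => dirDeriv (dirTime + dirOne) f (nullPoint t s y) := by
    funext t s y
    rw [dirDeriv_add, ept, e1, nullPoint]
  have eX : (fun t s y => pdx 0 (φ t) (mkE (t + s) y)) =
      fun t s y => dirDeriv dirOne f (nullPoint t s y) := by
    funext t s y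
    rw [e1, nullPoint]
  have eY : (fun t s y => pdx 1 (φ t) (mkE (t + s) y)) =
      fun t s y => dirDeriv dirTwo f (nullPoint t s y) := by
    funext t s y
    rw [e2, nullPoint]
  have wave : ∀ q : ℝ × E2, dirDeriv dirTime (dirDeriv dirTime f) q -
      (dirDeriv dirOne (dirDeriv dirOne f) q + dirDeriv dirTwo (dirDeriv dirTwo f) q) =
      -(|f q| ^ (p - 1) * f q) := by
    rintro ⟨t, x⟩
    rw [← hsol t x, ptt, lap, Fin.sum_univ_two, funext (e1 t), funext (e2 t),
      show (fun s => pt φ s x) = fun s => dirDeriv dirTime f (s, x) from funext fun s => ept s x,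
      deriv_slice_eq_dirDeriv (d _), pdx_slice_eq_dirDeriv (d _), pdx_slice_eq_dirDeriv (d _)]
    rfl
  rw [eL, eX, eY]
  refine ⟨fun t s y =>
      dirDeriv (dirTime + dirOne) (dirDeriv (dirTime + dirOne) f) (nullPoint t s y),
    fun t s y => dirDeriv dirOne (dirDeriv (dirTime + dirOne) f) (nullPoint t s y),
    fun t s y => dirDeriv dirTwo (dirDeriv (dirTime + dirOne) f) (nullPoint t s y),
    fun t s y => dirDeriv dirTwo (dirDeriv dirOne f) (nullPoint t s y),
    fun t s y => dirDeriv dirTwo (dirDeriv dirTwo f) (nullPoint t s y), ?_⟩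
  exact
  { cψ := continuous_comp_nullPoint hsm
    cL := continuous_comp_nullPoint (d _)
    cX := continuous_comp_nullPoint (d _)
    cY := continuous_comp_nullPoint (d _)
    cLL := continuous_comp_nullPoint (contDiff_dirDeriv (d _) _)
    cLX := continuous_comp_nullPoint (contDiff_dirDeriv (d _) _)
    cLY := continuous_comp_nullPoint (contDiff_dirDeriv (d _) _)
    cXY := continuous_comp_nullPoint (contDiff_dirDeriv (d _) _)
    cYY := continuous_comp_nullPoint (contDiff_dirDeriv (d _) _)
    ψt := fun t s y => hasDerivAt_comp_curve hsm (hasDerivAt_nullPoint_fst t s y)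
    ψs := fun t s y => hasDerivAt_comp_curve hsm (hasDerivAt_nullPoint_snd t s y)
    ψy := fun t s y => hasDerivAt_comp_curve hsm (hasDerivAt_nullPoint_thd t s y)
    Lt := fun t s y => hasDerivAt_comp_curve (d _) (hasDerivAt_nullPoint_fst t s y)
    Ls := fun t s y => hasDerivAt_comp_curve (d _) (hasDerivAt_nullPoint_snd t s y)
    Ly := fun t s y => hasDerivAt_comp_curve (d _) (hasDerivAt_nullPoint_thd t s y)
    Xt := fun t s y => (hasDerivAt_comp_curve (d _) (hasDerivAt_nullPoint_fst t s y)).congr_deriv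
      (dirDeriv_comm hsm _ _ _)
    Xy := fun t s y => hasDerivAt_comp_curve (d _) (hasDerivAt_nullPoint_thd t s y)
    Yt := fun t s y => (hasDerivAt_comp_curve (d _) (hasDerivAt_nullPoint_fst t s y)).congr_deriv
      (dirDeriv_comm hsm _ _ _)
    Ys := fun t s y => (hasDerivAt_comp_curve (d _) (hasDerivAt_nullPoint_snd t s y)).congr_deriv
      (dirDeriv_comm hsm _ _ _)
    Yy := fun t s y => hasDerivAt_comp_curve (d _) (hasDerivAt_nullPoint_thd t s y)
    wave := fun t s y => by
      have h := wave (nullPoint t s y)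
      change _ = -(|φ t (mkE (t + s) y)| ^ (p - 1) * φ t (mkE (t + s) y)) at h
      have hadd : ∀ v q, dirDeriv v (dirDeriv (dirTime + dirOne) f) q =
          dirDeriv v (dirDeriv dirTime f) q + dirDeriv v (dirDeriv dirOne f) q := by
        intro v q
        rw [dirDeriv_comm hsm, dirDeriv_add, dirDeriv_comm hsm, dirDeriv_comm hsm dirOne]
      rw [dirDeriv_add, hadd, hadd, dirDeriv_comm hsm dirTime dirOne]
      linear_combination h }

end

/-- The coordinates `(x₁ - T, x₂)` of the plane, as a measurable equivalence. -/
def shiftEquiv (T : ℝ) : ℝ × ℝ ≃ᵐ E2 :=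
  ((MeasurableEquiv.prodCongr (MeasurableEquiv.addLeft T) (MeasurableEquiv.refl ℝ)).trans
    MeasurableEquiv.finTwoArrow.symm).trans (MeasurableEquiv.toLp 2 (Fin 2 → ℝ))

lemma shiftEquiv_apply (T : ℝ) (z : ℝ × ℝ) : shiftEquiv T z = mkE (T + z.1) z.2 := by
  ext i
  fin_cases i
  · rw [Fin.zero_eta, mkE_apply_zero]
    rfl
  · rw [Fin.mk_one, mkE_apply_one]
    rfl

lemma measurePreserving_shiftEquiv (T : ℝ) : MeasurePreserving (shiftEquiv T) :=
  (((measurePreserving_add_left volume T).prod (MeasurePreserving.id volume)).trans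
    (volume_preserving_finTwoArrow ℝ).symm).trans (PiLp.volume_preserving_toLp (Fin 2))

lemma setIntegral_halfPlane (T : ℝ) (g : E2 → ℝ) :
    ∫ x in {x : E2 | x 0 ≤ T}, g x = ∫ z in Iic 0 ×ˢ univ, g (mkE (T + z.1) z.2) := by
  rw [← (measurePreserving_shiftEquiv T).setIntegral_preimage_emb
    (shiftEquiv T).measurableEmbedding]
  simp only [shiftEquiv_apply]
  congr 2
  ext z
  simp [shiftEquiv_apply]

lemma integrable_comp_mkE {g : E2 → ℝ} (hg : Integrable g) :
    Integrable fun z : ℝ × ℝ => g (mkE z.1 z.2) := by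
  have h := ((measurePreserving_shiftEquiv 0).integrable_comp_emb
    (shiftEquiv 0).measurableEmbedding).2 hg
  simpa [Function.comp_def, shiftEquiv_apply] using h

/-- Fatou lemma for a nonnegative function whose truncations have bounded integrals. -/
lemma integrable_and_integral_le_of_cutoff {α : Type*} [MeasurableSpace α] {μ : Measure α}
    {c : ℕ → α → ℝ} {g : α → ℝ} {C : ℝ} (hc0 : ∀ n x, 0 ≤ c n x) (hc1 : ∀ n x, c n x ≤ 1)
    (hlim : ∀ x, Tendsto (fun n => c n x) atTop (nhds 1)) (hg : ∀ᵐ x ∂μ, 0 ≤ g x)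
    (hi : ∀ n, Integrable (fun x => c n x * g x) μ) (hb : ∀ n, ∫ x, c n x * g x ∂μ ≤ C) :
    Integrable g μ ∧ ∫ x, g x ∂μ ≤ C := by
  have hl : ∀ x, Tendsto (fun n => c n x * g x) atTop (nhds (g x)) := fun x => by
    simpa using (hlim x).mul_const (g x)
  have hm : AEStronglyMeasurable g μ := aestronglyMeasurable_of_tendsto_ae atTop
    (fun n => (hi n).aestronglyMeasurable) (Eventually.of_forall hl)
  have hn : ∀ n, ∫⁻ x, ‖c n x * g x‖ₑ ∂μ ≤ ENNReal.ofReal C := by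
    intro n
    rw [← ofReal_integral_norm_eq_lintegral_enorm (hi n)]
    refine ENNReal.ofReal_le_ofReal (le_of_eq_of_le (integral_congr_ae ?_) (hb n))
    filter_upwards [hg] with x hx
    exact norm_of_nonneg (mul_nonneg (hc0 n x) hx)
  have hgi : Integrable g μ := by
    refine ⟨hm, lt_of_le_of_lt ?_ (ENNReal.ofReal_lt_top (r := C))⟩
    calc ∫⁻ x, ‖g x‖ₑ ∂μ = ∫⁻ x, liminf (fun n => ‖c n x * g x‖ₑ) atTop ∂μ :=
          lintegral_congr fun x => (hl x).enorm.liminf_eq.symm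
      _ ≤ liminf (fun n => ∫⁻ x, ‖c n x * g x‖ₑ ∂μ) atTop :=
          lintegral_liminf_le' fun n => (hi n).aestronglyMeasurable.enorm
      _ ≤ ENNReal.ofReal C := by
          refine (liminf_le_liminf (Eventually.of_forall hn)).trans_eq ?_
          simp
  refine ⟨hgi, le_of_tendsto (tendsto_integral_of_dominated_convergence g
    (fun n => (hi n).aestronglyMeasurable) hgi (fun n => ?_) (Eventually.of_forall hl))
    (Eventually.of_forall hb)⟩
  filter_upwards [hg] with x hx
  rw [norm_of_nonneg (mul_nonneg (hc0 n x) hx)]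
  exact mul_le_of_le_one_left hx (hc1 n x)

/-- An iterated integral over a box of a function vanishing elsewhere on a larger set. -/
lemma integrableOn_and_box_integral_eq {G : ℝ × ℝ → ℝ} {a b c d : ℝ} (hab : a ≤ b) (hcd : c ≤ d)
    {s : Set (ℝ × ℝ)} (hs : MeasurableSet s) (hsub : Ioc a b ×ˢ Ioc c d ⊆ s)
    (hc : ContinuousOn G (Icc a b ×ˢ Icc c d)) (h0 : ∀ z ∈ s \ Ioc a b ×ˢ Ioc c d, G z = 0) :
    IntegrableOn G s ∧ ∫ x in a..b, ∫ y in c..d, G (x, y) = ∫ z in s, G z := by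
  have hi : IntegrableOn G (Ioc a b ×ˢ Ioc c d) :=
    (hc.integrableOn_compact (isCompact_Icc.prod isCompact_Icc)).mono_set
      (prod_mono Ioc_subset_Icc_self Ioc_subset_Icc_self)
  refine ⟨hi.of_forall_sdiff_eq_zero hs h0, ?_⟩
  rw [setIntegral_eq_of_subset_of_forall_sdiff_eq_zero hs hsub h0, Measure.volume_eq_prod,
    setIntegral_prod _ (by rwa [← Measure.volume_eq_prod]), intervalIntegral.integral_of_le hab]
  simp only [intervalIntegral.integral_of_le hcd]

section

variable {p : ℝ} {ψ L X Y LL LX LY XY YY : ℝ → ℝ → ℝ → ℝ}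

/-- The conformal energy density of the data, in null coordinates. -/
def conformalDensity (p : ℝ) (ψ L X Y : ℝ → ℝ → ℝ → ℝ) (z : ℝ × ℝ) : ℝ :=
  (1 + z.1 ^ 2 + z.2 ^ 2) * ((L 0 z.1 z.2 - X 0 z.1 z.2) ^ 2 + X 0 z.1 z.2 ^ 2 + Y 0 z.1 z.2 ^ 2
    + |ψ 0 z.1 z.2| ^ (p + 1))

lemma two_mul_potential (p z : ℝ) : 2 / (p + 1) * |z| ^ (p + 1) = 2 * potential p z := by
  rw [potential]; ring

lemma potential_le {p : ℝ} (hp : 1 < p) (z : ℝ) : potential p z ≤ |z| ^ (p + 1) :=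
  div_le_self (rpow_nonneg (abs_nonneg z) _) (by linarith)

lemma causalCutoff_eq_zero_of_not_mem_Ioc {n : ℕ} {t y S : ℝ} (s : ℝ) (ht : 0 ≤ t)
    (hS : n + 1 ≤ S) (hy : y ∉ Ioc (-S) S) : causalCutoff n t s y = 0 := by
  refine causalCutoff_eq_zero ht ?_
  have hn : (0 : ℝ) ≤ n := n.cast_nonneg
  have : (n + 1 : ℝ) ≤ |y| := by
    by_contra! h
    have := abs_lt.1 h
    exact hy ⟨by linarith, by linarith⟩
  nlinarith [sq_abs y, sq_nonneg (t + s)]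

lemma causalCutoff_eq_zero_of_le {n : ℕ} {t s S : ℝ} (y : ℝ) (ht : 0 ≤ t)
    (hS : t + n + 1 ≤ S) (hs : s ≤ -S) : causalCutoff n t s y = 0 := by
  refine causalCutoff_eq_zero ht ?_
  have hn : (0 : ℝ) ≤ n := n.cast_nonneg
  nlinarith [sq_nonneg y]

/-- The characteristic flux is finite. -/
lemma NullFrame.integrableOn_flux (F : NullFrame p ψ L X Y LL LX LY XY YY) (hp : 1 < p) {T : ℝ}
    (hT : 0 ≤ T) (hE : Integrable (conformalDensity p ψ L X Y)) :
    IntegrableOn (fun z : ℝ × ℝ => (z.2 * L z.1 0 z.2 + Y z.1 0 z.2) ^ 2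
      + 2 / (p + 1) * |ψ z.1 0 z.2| ^ (p + 1)) (Ioc 0 T ×ˢ univ) := by
  have cV := (continuous_potential hp).comp F.cψ
  simp only [Function.comp_def] at cV
  have := F.cψ; have := F.cL; have := F.cX; have := F.cY
  set e : ℝ × ℝ → ℝ := fun z => exp (-z.1) * (1 + z.1 ^ 2 + z.2 ^ 2) *
    ((L z.1 0 z.2 ^ 2 + Y z.1 0 z.2 ^ 2) / 2 + potential p (ψ z.1 0 z.2)) with he
  have ci : Continuous fun z : ℝ × ℝ => (z.1, (0 : ℝ), z.2) := by fun_prop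
  have cj : Continuous fun z : ℝ × ℝ => ((0 : ℝ), z.1, z.2) := by fun_prop
  have c1 := F.cψ.comp ci
  have c2 := F.cL.comp ci
  have c3 := F.cY.comp ci
  have c4 := cV.comp ci
  have d1 := cV.comp cj
  have d2 := F.cL.comp cj
  have d3 := F.cY.comp cj
  have d4 := F.cX.comp cj
  simp only [Function.comp_def] at c1 c2 c3 c4 d1 d2 d3 d4
  have ce : Continuous e := by fun_prop
  have e0 : ∀ z, 0 ≤ e z := fun z => by
    have := potential_nonneg hp (ψ z.1 0 z.2)
    positivity
  have hm : MeasurableSet (Ioc 0 T ×ˢ (univ : Set ℝ)) := measurableSet_Ioc.prod .univ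
  have hbox : ∀ n : ℕ, IntegrableOn (fun z : ℝ × ℝ => causalCutoff n z.1 0 z.2 * e z)
      (Ioc 0 T ×ˢ univ) ∧
        ∫ t in 0..T, ∫ y in -(n + 1 : ℝ)..(n + 1), causalCutoff n t 0 y * e (t, y) =
          ∫ z in Ioc 0 T ×ˢ univ, causalCutoff n z.1 0 z.2 * e z := by
    intro n
    have hn : (0 : ℝ) ≤ n := n.cast_nonneg
    have cχ := (continuous_causalCutoff n).comp ci
    simp only [Function.comp_def] at cχ
    refine integrableOn_and_box_integral_eq
      (G := fun z : ℝ × ℝ => causalCutoff n z.1 0 z.2 * e z) hT (by linarith) hm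
      (prod_mono subset_rfl (subset_univ _)) (cχ.mul ce).continuousOn ?_
    rintro ⟨t, y⟩ ⟨⟨ht, -⟩, h2⟩
    have hy : y ∉ Ioc (-(n + 1 : ℝ)) (n + 1) := fun hy => h2 ⟨ht, hy⟩
    simp only
    rw [causalCutoff_eq_zero_of_not_mem_Ioc 0 ht.1.le le_rfl hy, zero_mul]
  have hbd : ∀ n : ℕ, ∫ z in Ioc 0 T ×ˢ univ, causalCutoff n z.1 0 z.2 * e z ≤
      ∫ z, conformalDensity p ψ L X Y z := by
    intro n
    have hn : (0 : ℝ) ≤ n := n.cast_nonneg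
    rw [← (hbox n).2]
    refine (F.energy_flux_le hp hT hn).trans ?_
    have h := (integrableOn_and_box_integral_eq (G := fun z : ℝ × ℝ => (1 + z.1 ^ 2 + z.2 ^ 2) *
        (((L 0 z.1 z.2 - X 0 z.1 z.2) ^ 2 + X 0 z.1 z.2 ^ 2 + Y 0 z.1 z.2 ^ 2) / 2
          + potential p (ψ 0 z.1 z.2))) (a := 0) (b := n + 1) (c := -(n + 1 : ℝ)) (d := n + 1)
        (by linarith) (by linarith) (measurableSet_Ioc.prod measurableSet_Ioc) subset_rfl
        (Continuous.continuousOn (by fun_prop)) (by simp))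
    rw [h.2]
    have hE0 : ∀ z, 0 ≤ conformalDensity p ψ L X Y z := fun z => by
      have := rpow_nonneg (abs_nonneg (ψ 0 z.1 z.2)) (p + 1)
      rw [conformalDensity]
      positivity
    refine (setIntegral_mono h.1 hE.integrableOn fun z => ?_).trans
      (setIntegral_le_integral hE (Eventually.of_forall hE0))
    have := potential_le hp (ψ 0 z.1 z.2)
    simp only [conformalDensity]
    gcongr
    nlinarith [sq_nonneg (L 0 z.1 z.2 - X 0 z.1 z.2), sq_nonneg (X 0 z.1 z.2),
      sq_nonneg (Y 0 z.1 z.2)]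
  have hei := (integrable_and_integral_le_of_cutoff (μ := volume.restrict (Ioc 0 T ×ˢ univ))
    (c := fun n (z : ℝ × ℝ) => causalCutoff n z.1 0 z.2) (g := e)
    (fun n z => causalCutoff_nonneg _ _ _ _) (fun n z => causalCutoff_le_one _ _ _ _)
    (fun z => tendsto_causalCutoff _ _ _) (Eventually.of_forall e0) (fun n => (hbox n).1) hbd).1
  simp only [two_mul_potential]
  refine Integrable.mono' (hei.const_mul (2 * exp T))
    (Continuous.aestronglyMeasurable (by fun_prop)) ?_
  filter_upwards [ae_restrict_mem hm] with z hz
  have hV := potential_nonneg hp (ψ z.1 0 z.2)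
  rw [norm_of_nonneg (by positivity)]
  have h1 : 2 * exp T * e z = 2 * (exp (T - z.1)) * ((1 + z.1 ^ 2 + z.2 ^ 2) *
      ((L z.1 0 z.2 ^ 2 + Y z.1 0 z.2 ^ 2) / 2 + potential p (ψ z.1 0 z.2))) := by
    rw [he, sub_eq_add_neg, exp_add]; ring
  have h2 : 1 ≤ exp (T - z.1) := one_le_exp (by linarith [hz.1.2])
  have h3 : (z.2 * L z.1 0 z.2 + Y z.1 0 z.2) ^ 2 ≤
      (1 + z.2 ^ 2) * (L z.1 0 z.2 ^ 2 + Y z.1 0 z.2 ^ 2) := by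
    nlinarith [sq_nonneg (L z.1 0 z.2 - z.2 * Y z.1 0 z.2)]
  rw [h1]
  calc (z.2 * L z.1 0 z.2 + Y z.1 0 z.2) ^ 2 + 2 * potential p (ψ z.1 0 z.2)
      ≤ 2 * 1 * ((1 + z.1 ^ 2 + z.2 ^ 2) *
        ((L z.1 0 z.2 ^ 2 + Y z.1 0 z.2 ^ 2) / 2 + potential p (ψ z.1 0 z.2))) := by
        have a1 : 0 ≤ z.1 ^ 2 * (L z.1 0 z.2 ^ 2 + Y z.1 0 z.2 ^ 2) := by positivity
        have a2 : 0 ≤ (z.1 ^ 2 + z.2 ^ 2) * potential p (ψ z.1 0 z.2) := by positivity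
        linarith
    _ ≤ _ := by gcongr

lemma nullDensity_nonneg {p u : ℝ} (hp : 1 < p) (hu : 0 ≤ u) (y z l k m : ℝ) :
    0 ≤ nullDensity p u y z l k m := by
  have := potential_nonneg hp z
  rw [nullDensity_eq]
  positivity

lemma continuousOn_nullDensity (F : NullFrame p ψ L X Y LL LX LY XY YY) (hp : 1 < p) (t : ℝ) :
    ContinuousOn (fun z : ℝ × ℝ => nullDensity p (1 - z.1) z.2 (ψ t z.1 z.2) (L t z.1 z.2)
      (L t z.1 z.2 - 2 * X t z.1 z.2) (Y t z.1 z.2)) (Iic 0 ×ˢ univ) := by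
  have ci : Continuous fun z : ℝ × ℝ => (t, z.1, z.2) := by fun_prop
  have c1 := F.cψ.comp ci
  have c2 := F.cL.comp ci
  have c3 := F.cY.comp ci
  have c4 := F.cX.comp ci
  have c5 := ((continuous_potential hp).comp F.cψ).comp ci
  simp only [Function.comp_def] at c1 c2 c3 c4 c5
  simp only [nullDensity_eq]
  refine ContinuousOn.mul ?_ (Continuous.continuousOn (by fun_prop))
  refine ContinuousOn.rpow_const (by fun_prop) fun z hz => Or.inl ?_
  have : z.1 ≤ 0 := hz.1
  linarith

/-- The initial energy associated with `J^M` is finite. -/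
lemma NullFrame.integrableOn_nullDensity_zero (F : NullFrame p ψ L X Y LL LX LY XY YY)
    (hp : 1 < p) (hp5 : p < 5) (hE : Integrable (conformalDensity p ψ L X Y)) :
    IntegrableOn (fun z : ℝ × ℝ => nullDensity p (1 - z.1) z.2 (ψ 0 z.1 z.2) (L 0 z.1 z.2)
      (L 0 z.1 z.2 - 2 * X 0 z.1 z.2) (Y 0 z.1 z.2)) (Iic 0 ×ˢ univ) := by
  have hP : ∀ z : ℝ × ℝ, 0 ≤ |ψ 0 z.1 z.2| ^ (p + 1) := fun z => rpow_nonneg (abs_nonneg _) _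
  have ci : Continuous fun z : ℝ × ℝ => ((0 : ℝ), z.1, z.2) := by fun_prop
  have c1 := F.cψ.comp ci
  have c3 := F.cY.comp ci
  simp only [Function.comp_def] at c1 c3
  have hψ : Integrable fun z : ℝ × ℝ => ψ 0 z.1 z.2 ^ 2 := by
    refine hardy_plane (f' := Y 0) (q := p + 1) (by linarith) (F.ψy 0) c1 c3 ?_ ?_
    · refine hE.mono' (Continuous.aestronglyMeasurable (by fun_prop))
        (Eventually.of_forall fun z => ?_)
      rw [norm_of_nonneg (by positivity), conformalDensity, mul_pow]
      have := hP z
      gcongr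
      · linarith [sq_nonneg z.1]
      · linarith [sq_nonneg (L 0 z.1 z.2 - X 0 z.1 z.2), sq_nonneg (X 0 z.1 z.2)]
    · refine hE.mono' (c1.abs.rpow_const fun _ => Or.inr (by linarith)).aestronglyMeasurable
        (Eventually.of_forall fun z => ?_)
      rw [norm_of_nonneg (hP z), conformalDensity]
      have := hP z
      have h1 : 0 ≤ (L 0 z.1 z.2 - X 0 z.1 z.2) ^ 2 + X 0 z.1 z.2 ^ 2 + Y 0 z.1 z.2 ^ 2 := by
        positivity
      nlinarith [sq_nonneg z.1, sq_nonneg z.2, mul_nonneg (sq_nonneg z.1) this,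
        mul_nonneg (sq_nonneg z.2) this, mul_nonneg (sq_nonneg z.1) h1,
        mul_nonneg (sq_nonneg z.2) h1]
  have hm : MeasurableSet (Iic (0 : ℝ) ×ˢ (univ : Set ℝ)) := measurableSet_Iic.prod .univ
  refine Integrable.mono' ((hE.const_mul 8).add hψ).integrableOn
    ((continuousOn_nullDensity F hp 0).aestronglyMeasurable hm) ?_
  filter_upwards [ae_restrict_mem hm] with z hz
  have hs : z.1 ≤ 0 := hz.1
  rw [norm_of_nonneg (nullDensity_nonneg hp (by linarith) _ _ _ _ _), nullDensity_eq]
  simp only [Pi.add_apply, conformalDensity]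
  have hu1 : (1 - z.1) ^ ((p - 5) / 2) ≤ 1 :=
    rpow_le_one_of_one_le_of_nonpos (by linarith) (by linarith)
  have hV := potential_le hp (ψ 0 z.1 z.2)
  have hV0 := potential_nonneg hp (ψ 0 z.1 z.2)
  refine (mul_le_of_le_one_left (by positivity) hu1).trans ?_
  generalize potential p (ψ 0 z.1 z.2) = V at *
  generalize |ψ 0 z.1 z.2| ^ (p + 1) = P at *
  generalize L 0 z.1 z.2 = l at *
  generalize X 0 z.1 z.2 = x at *
  generalize Y 0 z.1 z.2 = m at *
  generalize ψ 0 z.1 z.2 = f at *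
  obtain ⟨s, y⟩ := z
  simp only at *
  set u := 1 - s with hu
  set w := 1 + s ^ 2 + y ^ 2 with hw
  have hw0 : 0 ≤ w := by positivity
  have huw : u ^ 2 + y ^ 2 ≤ 2 * w := by
    rw [hu, hw]; nlinarith [sq_nonneg (1 + s), sq_nonneg y]
  have b1 : (y * l + u * m) ^ 2 ≤ 2 * w * (l ^ 2 + m ^ 2) :=
    le_trans (by nlinarith [sq_nonneg (y * m - u * l)])
      (mul_le_mul_of_nonneg_right huw (by positivity))
  have b2 : (u * (l - 2 * x) + y * m) ^ 2 ≤ 2 * w * ((l - 2 * x) ^ 2 + m ^ 2) :=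
    le_trans (by nlinarith [sq_nonneg (u * m - y * (l - 2 * x))])
      (mul_le_mul_of_nonneg_right huw (by positivity))
  have b3 : (u ^ 2 + y ^ 2) * V ≤ 2 * w * P := by gcongr
  have b4 : w * l ^ 2 ≤ w * (2 * (l - x) ^ 2 + 2 * x ^ 2) := by
    gcongr; nlinarith [sq_nonneg (l - 2 * x)]
  have b5 : w * (l - 2 * x) ^ 2 ≤ w * (2 * (l - x) ^ 2 + 2 * x ^ 2) := by
    gcongr; nlinarith [sq_nonneg l]
  have b6 : (u * (l - 2 * x) + y * m + f) ^ 2 ≤ 2 * (u * (l - 2 * x) + y * m) ^ 2 + 2 * f ^ 2 := by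
    nlinarith [sq_nonneg (u * (l - 2 * x) + y * m - f)]
  have b7 : 0 ≤ w * (l - x) ^ 2 := by positivity
  have b8 : 0 ≤ w * x ^ 2 := by positivity
  have b9 : 0 ≤ w * m ^ 2 := by positivity
  have b10 : 0 ≤ w * P := mul_nonneg hw0 (hV0.trans hV)
  linarith

/-- The energy estimate for `J^M` in null coordinates. -/
lemma NullFrame.integral_nullDensity_le (F : NullFrame p ψ L X Y LL LX LY XY YY) (hp : 1 < p)
    (hp5 : p < 5) {T : ℝ} (hT : 0 ≤ T) (hE : Integrable (conformalDensity p ψ L X Y)) :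
    ∫ z in Iic 0 ×ˢ univ, nullDensity p (1 - z.1) z.2 (ψ T z.1 z.2) (L T z.1 z.2)
        (L T z.1 z.2 - 2 * X T z.1 z.2) (Y T z.1 z.2) ≤
      (∫ z in Iic 0 ×ˢ univ, nullDensity p (1 - z.1) z.2 (ψ 0 z.1 z.2) (L 0 z.1 z.2)
        (L 0 z.1 z.2 - 2 * X 0 z.1 z.2) (Y 0 z.1 z.2)) +
      ∫ t in 0..T, ∫ y, ((y * L t 0 y + Y t 0 y) ^ 2 + 2 / (p + 1) * |ψ t 0 y| ^ (p + 1)) := by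
  set d : ℝ → ℝ × ℝ → ℝ := fun t z => nullDensity p (1 - z.1) z.2 (ψ t z.1 z.2) (L t z.1 z.2)
    (L t z.1 z.2 - 2 * X t z.1 z.2) (Y t z.1 z.2) with hd
  set g : ℝ × ℝ → ℝ := fun z => (z.2 * L z.1 0 z.2 + Y z.1 0 z.2) ^ 2
    + 2 / (p + 1) * |ψ z.1 0 z.2| ^ (p + 1) with hg
  have hH : MeasurableSet (Iic (0 : ℝ) ×ˢ (univ : Set ℝ)) := measurableSet_Iic.prod .univ
  have hQ : MeasurableSet (Ioc 0 T ×ˢ (univ : Set ℝ)) := measurableSet_Ioc.prod .univ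
  have hgi : IntegrableOn g (Ioc 0 T ×ˢ univ) := F.integrableOn_flux hp hT hE
  have hdi : IntegrableOn (d 0) (Iic 0 ×ˢ univ) := F.integrableOn_nullDensity_zero hp hp5 hE
  have hd0 : ∀ t, ∀ z ∈ Iic (0 : ℝ) ×ˢ (univ : Set ℝ), 0 ≤ d t z := fun t z hz =>
    nullDensity_nonneg hp (by have : z.1 ≤ 0 := hz.1; linarith) _ _ _ _ _
  have hg0 : ∀ z, 0 ≤ g z := fun z => by
    have := rpow_nonneg (abs_nonneg (ψ z.1 0 z.2)) (p + 1)
    have : 0 < p + 1 := by linarith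
    positivity
  have hflux : ∫ t in 0..T, ∫ y, ((y * L t 0 y + Y t 0 y) ^ 2
      + 2 / (p + 1) * |ψ t 0 y| ^ (p + 1)) = ∫ z in Ioc 0 T ×ˢ univ, g z := by
    rw [Measure.volume_eq_prod, setIntegral_prod _ (by rwa [← Measure.volume_eq_prod]),
      intervalIntegral.integral_of_le hT]
    simp only [Measure.restrict_univ, hg]
  have hcg : Continuous g := by
    have ci : Continuous fun z : ℝ × ℝ => (z.1, (0 : ℝ), z.2) := by fun_prop
    have c1 := ((continuous_potential hp).comp F.cψ).comp ci
    have c2 := F.cL.comp ci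
    have c3 := F.cY.comp ci
    simp only [Function.comp_def] at c1 c2 c3
    simp only [hg, two_mul_potential]
    fun_prop
  have hbox : ∀ t, 0 ≤ t → t ≤ T → ∀ n : ℕ,
      IntegrableOn (fun z : ℝ × ℝ => causalCutoff n t z.1 z.2 * d t z) (Iic 0 ×ˢ univ) ∧
        ∫ s in -(T + n + 1)..0, ∫ y in -(T + n + 1)..(T + n + 1),
            causalCutoff n t s y * d t (s, y) =
          ∫ z in Iic 0 ×ˢ univ, causalCutoff n t z.1 z.2 * d t z := by
    intro t ht htT n
    have hn : (0 : ℝ) ≤ n := n.cast_nonneg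
    have cχ : Continuous fun z : ℝ × ℝ => causalCutoff n t z.1 z.2 :=
      (continuous_causalCutoff n).comp (f := fun z : ℝ × ℝ => (t, z.1, z.2)) (by fun_prop)
    refine integrableOn_and_box_integral_eq
      (G := fun z : ℝ × ℝ => causalCutoff n t z.1 z.2 * d t z) (by linarith) (by linarith) hH
      (prod_mono Ioc_subset_Iic_self (subset_univ _)) (cχ.continuousOn.mul
        ((continuousOn_nullDensity F hp t).mono (prod_mono Icc_subset_Iic_self (subset_univ _)))) ?_
    rintro ⟨s, y⟩ ⟨⟨hs, -⟩, h2⟩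
    simp only
    by_cases hy : y ∈ Ioc (-(T + n + 1)) (T + n + 1)
    · have hs' : s ≤ -(T + n + 1) := by
        by_contra! h
        exact h2 ⟨⟨h, hs⟩, hy⟩
      rw [causalCutoff_eq_zero_of_le y ht (by linarith) hs', zero_mul]
    · rw [causalCutoff_eq_zero_of_not_mem_Ioc s ht (by linarith) hy, zero_mul]
  have hboxg : ∀ n : ℕ,
      IntegrableOn (fun z : ℝ × ℝ => causalCutoff n z.1 0 z.2 * g z) (Ioc 0 T ×ˢ univ) ∧
        ∫ t in 0..T, ∫ y in -(T + n + 1)..(T + n + 1), causalCutoff n t 0 y * g (t, y) =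
          ∫ z in Ioc 0 T ×ˢ univ, causalCutoff n z.1 0 z.2 * g z := by
    intro n
    have hn : (0 : ℝ) ≤ n := n.cast_nonneg
    have cχ : Continuous fun z : ℝ × ℝ => causalCutoff n z.1 0 z.2 :=
      (continuous_causalCutoff n).comp (f := fun z : ℝ × ℝ => (z.1, 0, z.2)) (by fun_prop)
    refine integrableOn_and_box_integral_eq
      (G := fun z : ℝ × ℝ => causalCutoff n z.1 0 z.2 * g z) hT (by linarith) hQ
      (prod_mono subset_rfl (subset_univ _)) (cχ.mul hcg).continuousOn ?_
    rintro ⟨t, y⟩ ⟨⟨ht, -⟩, h2⟩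
    simp only
    rw [causalCutoff_eq_zero_of_not_mem_Ioc 0 ht.1.le (by linarith) fun hy => h2 ⟨ht, hy⟩, zero_mul]
  rw [hflux]
  refine (integrable_and_integral_le_of_cutoff (μ := volume.restrict (Iic 0 ×ˢ univ))
    (c := fun n (z : ℝ × ℝ) => causalCutoff n T z.1 z.2) (g := d T)
    (fun n z => causalCutoff_nonneg _ _ _ _) (fun n z => causalCutoff_le_one _ _ _ _)
    (fun z => tendsto_causalCutoff _ _ _)
    ((ae_restrict_mem hH).mono (hd0 T)) (fun n => (hbox T hT le_rfl n).1) fun n => ?_).2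
  rw [← (hbox T hT le_rfl n).2]
  refine (F.cutoff_nullDensity_le hp hp5 hT n.cast_nonneg le_rfl).trans ?_
  refine add_le_add ((hbox 0 le_rfl hT n).2.trans_le ?_) ((hboxg n).2.trans_le ?_)
  · exact setIntegral_mono_on (hbox 0 le_rfl hT n).1 hdi hH fun z hz =>
      mul_le_of_le_one_left (hd0 0 z hz) (causalCutoff_le_one _ _ _ _)
  · exact setIntegral_mono (hboxg n).1 hgi fun z =>
      mul_le_of_le_one_left (hg0 z) (causalCutoff_le_one _ _ _ _)

end

lemma JM_mkE (p : ℝ) (φ : ℝ → E2 → ℝ) (t s y : ℝ) :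
    JM p φ t (mkE (t + s) y) = nullDensity p (1 - s) y (φ t (mkE (t + s) y))
      (pt φ t (mkE (t + s) y) + pdx 0 (φ t) (mkE (t + s) y))
      (pt φ t (mkE (t + s) y) + pdx 0 (φ t) (mkE (t + s) y) - 2 * pdx 0 (φ t) (mkE (t + s) y))
      (pdx 1 (φ t) (mkE (t + s) y)) := by
  rw [JM, nullDensity, mkE_apply_zero, mkE_apply_one, show t - (t + s) + 1 = 1 - s by ring]
  ring

lemma integrable_conformalDensity {p : ℝ} (hp : 1 < p) {φ : ℝ → E2 → ℝ}
    (hsm : ContDiff ℝ (⊤ : ℕ∞) (fun q : ℝ × E2 => φ q.1 q.2))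
    (hE02 : Integrable (e02Integrand p (φ 0) (pt φ 0))) :
    Integrable (conformalDensity p (fun t s y => φ t (mkE (t + s) y))
      (fun t s y => pt φ t (mkE (t + s) y) + pdx 0 (φ t) (mkE (t + s) y))
      (fun t s y => pdx 0 (φ t) (mkE (t + s) y)) (fun t s y => pdx 1 (φ t) (mkE (t + s) y))) := by
  have d := contDiff_dirDeriv hsm
  have cm : Continuous fun z : ℝ × ℝ => ((0 : ℝ), mkE (0 + z.1) z.2) := by
    simp only [zero_add]
    exact continuous_const.prodMk continuous_mkE
  have c0 : Continuous fun z : ℝ × ℝ => φ 0 (mkE (0 + z.1) z.2) := hsm.continuous.comp cm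
  have c1 : Continuous fun z : ℝ × ℝ => pt φ 0 (mkE (0 + z.1) z.2) :=
    ((d dirTime).continuous.comp cm).congr fun z => (deriv_slice_eq_dirDeriv hsm _ _).symm
  have c2 : ∀ i, Continuous fun z : ℝ × ℝ => pdx i (φ 0) (mkE (0 + z.1) z.2) := fun i =>
    ((d _).continuous.comp cm).congr fun z => (pdx_slice_eq_dirDeriv hsm _ _ i).symm
  have c3 := c2 0
  have c4 := c2 1
  have c5 : Continuous fun z : ℝ × ℝ => |φ 0 (mkE (0 + z.1) z.2)| ^ (p + 1) :=
    c0.abs.rpow_const fun _ => Or.inr (by linarith)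
  refine (integrable_comp_mkE hE02).mono' ?_ (Eventually.of_forall fun z => ?_)
  · refine Continuous.aestronglyMeasurable ?_
    unfold conformalDensity
    fun_prop
  · have hP := rpow_nonneg (abs_nonneg (φ 0 (mkE z.1 z.2))) (p + 1)
    simp only [conformalDensity, zero_add, e02Integrand, gradSq, Fin.sum_univ_two]
    rw [norm_of_nonneg (by positivity), ← mul_add]
    refine mul_le_mul ?_ (by linarith) (by positivity) (by positivity)
    nlinarith [norm_sq_mkE z.1 z.2, norm_nonneg (mkE z.1 z.2)]

/-- the energy estimate for the density `J^M` with characteristic flux term. -/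
theorem JM_energy_estimate
    (p : ℝ) (hp1 : 1 < p) (hp5 : p < 5)
    (φ : ℝ → E2 → ℝ)
    (hsm : ContDiff ℝ (⊤ : ℕ∞) (fun q : ℝ × E2 => φ q.1 q.2))
    (hsol : IsWaveSolR2 p φ)
    (hE02 : Integrable (e02Integrand p (φ 0) (pt φ 0))) :
    ∀ T : ℝ, 0 ≤ T →
      (∫ x in {x : E2 | x 0 ≤ T}, JM p φ T x)
        ≤ (∫ x in {x : E2 | x 0 ≤ 0}, JM p φ 0 x)
          + ∫ t in (0:ℝ)..T, ∫ x₂ : ℝ,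
              ((x₂ * (pt φ t (mkE t x₂) + pdx 0 (φ t) (mkE t x₂))
                  + pdx 1 (φ t) (mkE t x₂))^2
                + (2/(p+1)) * |φ t (mkE t x₂)| ^ (p+1)) := by
  intro T hT
  obtain ⟨LL, LX, LY, XY, YY, F⟩ := nullFrame_of_isWaveSolR2 hsm hsol
  have h := F.integral_nullDensity_le hp1 hp5 hT (integrable_conformalDensity hp1 hsm hE02)
  simp only [add_zero, ← JM_mkE] at h
  rwa [setIntegral_halfPlane, setIntegral_halfPlane]
end
end

section
/- Let p ∈ (1,5), R ≥ 1, r ≥ 0 and t ∈ ℝ with t + R ≥ r. Then ∫₀^{π/2} [ (t + r·cosθ + R + 1)^{(p−1)/2} − (t − r·cosθ + R + 1)^{(p−1)/2} ] cosθ dθ + ∫₀^{π/2} [ (t − r·cosθ + R + 1)^{(p−5)/2} − (t + r·cosθ + R + 1)^{(p−5)/2} ] r² cosθ sin²θ dθ + ∫₀^{π/2} [ (t − r·cosθ + R + 1)^{(p−3)/2} + (t + r·cosθ + R + 1)^{(p−3)/2} ] r sin²θ dθ ≥ 0. (This expresses the nonnegativity, on the obstacle boundary where t + R ≥ r, of the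 radial component of the spherically averaged multiplier vector field used in the proof of the potential energy decay.) -/
noncomputable section

open MeasureTheory Real Set Filter Pointwise

/-- nonnegativity of the radial component of the spherically averaged
multiplier vector field on the obstacle boundary. -/
theorem averaged_multiplier_radial_nonneg
    (p R r t : ℝ) (hp1 : 1 < p) (hp5 : p < 5) (hR : 1 ≤ R) (hr : 0 ≤ r)
    (htr : r ≤ t + R) :
    0 ≤ (∫ θ in (0:ℝ)..(π/2),
          ((t + r * Real.cos θ + R + 1) ^ ((p-1)/2)
            - (t - r * Real.cos θ + R + 1) ^ ((p-1)/2)) * Real.cos θ)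
      + (∫ θ in (0:ℝ)..(π/2),
          ((t - r * Real.cos θ + R + 1) ^ ((p-5)/2)
            - (t + r * Real.cos θ + R + 1) ^ ((p-5)/2))
            * (r^2 * Real.cos θ * (Real.sin θ)^2))
      + (∫ θ in (0:ℝ)..(π/2),
          ((t - r * Real.cos θ + R + 1) ^ ((p-3)/2)
            + (t + r * Real.cos θ + R + 1) ^ ((p-3)/2)) * (r * (Real.sin θ)^2)) := by
  have hcos : ∀ θ ∈ Icc (0:ℝ) (π/2), 0 ≤ Real.cos θ := fun θ hθ =>
    Real.cos_nonneg_of_mem_Icc ⟨by linarith [hθ.1, Real.pi_pos], hθ.2⟩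
  have hpos : ∀ θ, 0 < t - r * Real.cos θ + R + 1 := fun θ => by
    linarith [mul_le_of_le_one_right hr (Real.cos_le_one θ)]
  have hle : ∀ θ ∈ Icc (0:ℝ) (π/2),
      t - r * Real.cos θ + R + 1 ≤ t + r * Real.cos θ + R + 1 := fun θ hθ => by
    linarith [mul_nonneg hr (hcos θ hθ)]
  have hpi : (0:ℝ) ≤ π/2 := by positivity
  refine add_nonneg (add_nonneg ?_ ?_) ?_ <;>
    refine intervalIntegral.integral_nonneg hpi fun θ hθ => mul_nonneg ?_ ?_
  · exact sub_nonneg.2 (Real.rpow_le_rpow (hpos θ).le (hle θ hθ) (by linarith))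
  · exact hcos θ hθ
  · exact sub_nonneg.2 (Real.rpow_le_rpow_of_nonpos (hpos θ) (hle θ hθ) (by linarith))
  · have := hcos θ hθ
    positivity
  · have h₁ := hpos θ
    have h₂ := h₁.trans_le (hle θ hθ)
    exact add_nonneg (Real.rpow_nonneg h₁.le _) (Real.rpow_nonneg h₂.le _)
  · positivity
end
end
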